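/- For i ∈ [n] let δ_i := {max({0} ∪ (U ∩ {1,…,i})), min((D ∖ {1,…,i}) ∪ {n+2})} and δ'_i := {min((U ∖ {1,…,n+1−i}) ∪ {n+2}), max({0} ∪ (D ∩ {1,…,n+1−i}))}. Then T_min := {δ_1,…,δ_n} and T_max := {δ'_1,…,δ'_n} are triangulations of P with Bel(δ_i) = {1,…,i} and Bel(δ'_i) = {n+2−i,…,n+1} for all i ∈ [n]; moreover x(T_min) = (1,2,…,n+1) and x(T_max) = (n+1,n,…,1), and for every triangulation T of P with T ≠ T_min one has ⟨u⋆, x(T_min)⟩ < ⟨u⋆, x(T)⟩, while for every triangulation T ≠ T_max one has ⟨u⋆, x(T)⟩ < ⟨u⋆, x(T_max)⟩. -/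

import Mathlib

attribute [local instance] Classical.propDecidable

noncomputable section

namespace Spines

/-- Position of vertex `v ∈ {0,…,n+2}` in the counterclockwise boundary cyclic order:
`0`, then the elements of `D` in increasing order, then `n+2`, then the elements of `U`
in decreasing order. -/
def pos (n : ℕ) (D U : Finset ℕ) (v : ℕ) : ℕ :=
  if v = 0 then 0
  else if v = n + 2 then D.card + 1
  else if v ∈ D then 1 + (D.filter (fun d => d < v)).card
  else D.card + 2 + (U.filter (fun u => v < u)).card

/-- Cyclic distance from `a` to `v` in counterclockwise direction. -/
def relpos (n : ℕ) (D U : Finset ℕ) (a v : ℕ) : ℕ :=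
  (pos n D U v + (n + 3) - pos n D U a) % (n + 3)

/-- `v` lies strictly inside the counterclockwise boundary arc from `a` to `b`. -/
def StrictBetween (n : ℕ) (D U : Finset ℕ) (a b v : ℕ) : Prop :=
  v ≤ n + 2 ∧ 0 < relpos n D U a v ∧ relpos n D U a v < relpos n D U a b

/-- A diagonal, encoded as an ordered pair `(a,b)` with `a < b ≤ n+2`. -/
def IsDiag (n : ℕ) (δ : ℕ × ℕ) : Prop := δ.1 < δ.2 ∧ δ.2 ≤ n + 2

/-- A boundary edge: the endpoints are adjacent in the cyclic order. -/
def IsBoundaryEdge (n : ℕ) (D U : Finset ℕ) (δ : ℕ × ℕ) : Prop :=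
  IsDiag n δ ∧ (relpos n D U δ.1 δ.2 = 1 ∨ relpos n D U δ.2 δ.1 = 1)

/-- An internal diagonal. -/
def IsInternalDiag (n : ℕ) (D U : Finset ℕ) (δ : ℕ × ℕ) : Prop :=
  IsDiag n δ ∧ ¬ IsBoundaryEdge n D U δ

/-- Two diagonals cross: the four endpoints are pairwise distinct and exactly one
endpoint of the second lies strictly inside each of the two arcs determined by the first. -/
def Cross (n : ℕ) (D U : Finset ℕ) (δ δ' : ℕ × ℕ) : Prop :=
  δ.1 ≠ δ.2 ∧ δ'.1 ≠ δ'.2 ∧ δ.1 ≠ δ'.1 ∧ δ.1 ≠ δ'.2 ∧ δ.2 ≠ δ'.1 ∧ δ.2 ≠ δ'.2 ∧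
  ((StrictBetween n D U δ.1 δ.2 δ'.1 ∧ StrictBetween n D U δ.2 δ.1 δ'.2) ∨
   (StrictBetween n D U δ.1 δ.2 δ'.2 ∧ StrictBetween n D U δ.2 δ.1 δ'.1))

/-- A triangulation: a maximal set of pairwise non-crossing internal diagonals. -/
def IsTriangulation (n : ℕ) (D U : Finset ℕ) (T : Finset (ℕ × ℕ)) : Prop :=
  (∀ δ ∈ T, IsInternalDiag n D U δ) ∧
  (∀ δ ∈ T, ∀ δ' ∈ T, ¬ Cross n D U δ δ') ∧
  (∀ δ, IsInternalDiag n D U δ → δ ∉ T → ∃ δ' ∈ T, Cross n D U δ δ')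

/-- `a` and `b` (with `a < b`) are joined by a diagonal of `T` or a boundary edge. -/
def EdgeOf (n : ℕ) (D U : Finset ℕ) (T : Finset (ℕ × ℕ)) (a b : ℕ) : Prop :=
  (a, b) ∈ T ∨ IsBoundaryEdge n D U (a, b)

/-- `{i,j,k}` with `i<j<k` is a triangle of the triangulation `T`. -/
def IsTriangleOf (n : ℕ) (D U : Finset ℕ) (T : Finset (ℕ × ℕ)) (i j k : ℕ) : Prop :=
  i < j ∧ j < k ∧ k ≤ n + 2 ∧
    EdgeOf n D U T i j ∧ EdgeOf n D U T j k ∧ EdgeOf n D U T i k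

/-- `Bel δ`: labels in `[n+1]` strictly inside the ccw arc from `δ.1` to `δ.2`,
together with the endpoints of `δ` lying in `U`. -/
def Bel (n : ℕ) (D U : Finset ℕ) (δ : ℕ × ℕ) : Finset ℕ :=
  (Finset.Icc 1 (n + 1)).filter
    (fun j => StrictBetween n D U δ.1 δ.2 j ∨ (j ∈ U ∧ (j = δ.1 ∨ j = δ.2)))

def bel (n : ℕ) (D U : Finset ℕ) (δ : ℕ × ℕ) : ℕ := (Bel n D U δ).card

def Abo (n : ℕ) (D U : Finset ℕ) (δ : ℕ × ℕ) : Finset ℕ :=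
  Finset.Icc 1 (n + 1) \ Bel n D U δ

/-- The coordinates of the point `x(T)` associated to a triangulation `T`. -/
def xcoord (n : ℕ) (D U : Finset ℕ) (T : Finset (ℕ × ℕ)) (j : ℕ) : ℝ :=
  if h : ∃ p : ℕ × ℕ, IsTriangleOf n D U T p.1 j p.2 then
    if j ∈ D then
      ((bel n D U (h.choose.1, j) : ℝ) + 1) * ((bel n D U (j, h.choose.2) : ℝ) + 1)
    else
      ((n : ℝ) + 2) -
        (((n : ℝ) + 2) - (bel n D U (h.choose.1, j) : ℝ)) *
          (((n : ℝ) + 2) - (bel n D U (j, h.choose.2) : ℝ))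
  else 0

/-- Middle vertex of the triple `{a,b,c}` with `a < b` and `c ∉ {a,b}`. -/
def midOf (a b c : ℕ) : ℕ := if c < a then a else if c < b then c else b

/-- `c` is the third vertex of a triangle of `T` containing the diagonal `δ`. -/
def TriWith (n : ℕ) (D U : Finset ℕ) (T : Finset (ℕ × ℕ)) (δ : ℕ × ℕ) (c : ℕ) : Prop :=
  if c < δ.1 then IsTriangleOf n D U T c δ.1 δ.2
  else if c < δ.2 then IsTriangleOf n D U T δ.1 c δ.2
  else IsTriangleOf n D U T δ.1 δ.2 c

/-- `s_δ`: middle vertex of the triangle of `T` below `δ` (third vertex strictly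
inside the ccw arc from `δ.1` to `δ.2`). -/
def spineSrc (n : ℕ) (D U : Finset ℕ) (T : Finset (ℕ × ℕ)) (δ : ℕ × ℕ) : ℕ :=
  if h : ∃ c, StrictBetween n D U δ.1 δ.2 c ∧ TriWith n D U T δ c then
    midOf δ.1 δ.2 h.choose
  else 0

/-- `t_δ`: middle vertex of the triangle of `T` above `δ` (third vertex strictly
inside the ccw arc from `δ.2` to `δ.1`). -/
def spineTgt (n : ℕ) (D U : Finset ℕ) (T : Finset (ℕ × ℕ)) (δ : ℕ × ℕ) : ℕ :=
  if h : ∃ c, StrictBetween n D U δ.2 δ.1 c ∧ TriWith n D U T δ c then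
    midOf δ.1 δ.2 h.choose
  else 0

/-- `(p,q)` is an arc of the spine of `T`. -/
def SpineArc (n : ℕ) (D U : Finset ℕ) (T : Finset (ℕ × ℕ)) (p q : ℕ) : Prop :=
  ∃ δ ∈ T, spineSrc n D U T δ = p ∧ spineTgt n D U T δ = q

/-- The finite set of all triangulations of the polygon. -/
def allTri (n : ℕ) (D U : Finset ℕ) : Finset (Finset (ℕ × ℕ)) :=
  ((Finset.range (n + 3) ×ˢ Finset.range (n + 3)).filter
      (fun δ => IsInternalDiag n D U δ)).powerset.filter
    (fun T => IsTriangulation n D U T)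

end Spines

namespace Spines

/-- The diagonal `δ_i` of the minimal triangulation: its endpoints are
`max({0} ∪ (U ∩ [i]))` and `min((D ∖ [i]) ∪ {n+2})`. -/
def minDiag (n : ℕ) (D U : Finset ℕ) (i : ℕ) : ℕ × ℕ :=
  ((insert 0 (U ∩ Finset.Icc 1 i)).max' (Finset.insert_nonempty _ _),
   (insert (n + 2) (D \ Finset.Icc 1 i)).min' (Finset.insert_nonempty _ _))

/-- The diagonal `δ'_i` of the maximal triangulation: its endpoints are
`max({0} ∪ (D ∩ [n+1−i]))` and `min((U ∖ [n+1−i]) ∪ {n+2})` (listed in increasing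
order). -/
def maxDiag (n : ℕ) (D U : Finset ℕ) (i : ℕ) : ℕ × ℕ :=
  ((insert 0 (D ∩ Finset.Icc 1 (n + 1 - i))).max' (Finset.insert_nonempty _ _),
   (insert (n + 2) (U \ Finset.Icc 1 (n + 1 - i))).min' (Finset.insert_nonempty _ _))

/-- `D` and `U` partition the label set `{1,…,n+1}`. -/
structure IsLabelSplit (n : ℕ) (D U : Finset ℕ) : Prop where
  mem_or : ∀ v, v ∈ D ∨ v ∈ U ↔ 1 ≤ v ∧ v ≤ n + 1
  notMem : ∀ v ∈ D, v ∉ U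
  card_add : D.card + U.card = n + 1

theorem IsLabelSplit.of_union_eq {n : ℕ} {D U : Finset ℕ}
    (hUD : D ∪ U = Finset.Icc 1 (n + 1)) (hdisj : Disjoint D U) : IsLabelSplit n D U where
  mem_or v := by
    have h := congrArg (v ∈ ·) hUD
    simpa using h
  notMem v hv := Finset.disjoint_left.mp hdisj hv
  card_add := by
    rw [← Finset.card_union_of_disjoint hdisj, hUD]
    simp

theorem IsLabelSplit.symm {n : ℕ} {D U : Finset ℕ} (h : IsLabelSplit n D U) :
    IsLabelSplit n U D where
  mem_or v := by rw [or_comm]; exact h.mem_or v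
  notMem v hv hv' := h.notMem v hv' hv
  card_add := by rw [add_comm]; exact h.card_add

/-- For `a < b`, the vertex `v` lies strictly below the diagonal `{a,b}`. -/
def Under (D U : Finset ℕ) (a b v : ℕ) : Prop :=
  (v < a ∧ a ∈ U) ∨ (a < v ∧ v < b ∧ v ∈ D) ∨ (b < v ∧ b ∈ U)

section Positions

variable {n : ℕ} {D U : Finset ℕ}

theorem pos_le (h : IsLabelSplit n D U) {v : ℕ} (hv : v ≤ n + 2) : pos n D U v ≤ n + 2 := by
  have hc := h.card_add
  have h0 : v ∈ U → (U.filter (fun u => v < u)).card < U.card := fun hv =>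
    Finset.card_lt_card (Finset.filter_ssubset.mpr ⟨v, hv, lt_irrefl v⟩)
  have h1 := Finset.card_filter_le D (fun d => d < v)
  have h2 := h.mem_or v
  unfold pos
  split_ifs with c1 c2 c3
  · omega
  · omega
  · omega
  · have := h0 ((h2.mpr ⟨by omega, by omega⟩).resolve_left c3)
    omega

theorem pos_of_mem_left (h : IsLabelSplit n D U) {v : ℕ} (hv : v ∈ D) :
    pos n D U v = 1 + (D.filter (fun d => d < v)).card ∧
      (D.filter (fun d => d < v)).card < D.card := by
  have h2 := (h.mem_or v).mp (Or.inl hv)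
  refine ⟨?_, Finset.card_lt_card (Finset.filter_ssubset.mpr ⟨v, hv, lt_irrefl v⟩)⟩
  unfold pos
  rw [if_neg (by omega), if_neg (by omega), if_pos hv]

theorem pos_of_mem_right (h : IsLabelSplit n D U) {v : ℕ} (hv : v ∈ U) :
    pos n D U v = D.card + 2 + (U.filter (fun u => v < u)).card := by
  have h2 := (h.mem_or v).mp (Or.inr hv)
  unfold pos
  rw [if_neg (by omega), if_neg (by omega), if_neg (fun h' => h.notMem v h' hv)]

theorem pos_zero : pos n D U 0 = 0 := by simp [pos]

theorem pos_last : pos n D U (n + 2) = D.card + 1 := by simp [pos]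

theorem pos_lt_of_notMem (h : IsLabelSplit n D U) {v w : ℕ} (hvw : v < w) (hw : w ≤ n + 2)
    (hv : v ∉ U) : pos n D U v < pos n D U w := by
  have hwc : w = n + 2 ∨ w ∈ D ∨ w ∈ U := by
    have := h.mem_or w
    by_cases hw2 : w = n + 2
    · exact Or.inl hw2
    · exact Or.inr (this.mpr (by omega))
  have hvc : v = 0 ∨ v ∈ D := by
    have := h.mem_or v
    by_cases hv0 : v = 0
    · exact Or.inl hv0
    · exact Or.inr ((this.mpr (by omega)).resolve_right hv)
  rcases hvc with rfl | hvD
  · rw [pos_zero]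
    rcases hwc with rfl | hwD | hwU
    · rw [pos_last]; omega
    · have := pos_of_mem_left h hwD; omega
    · have := pos_of_mem_right h hwU; omega
  · have h1 := pos_of_mem_left h hvD
    rcases hwc with rfl | hwD | hwU
    · rw [pos_last]; omega
    · have h2 := pos_of_mem_left h hwD
      have : (D.filter (fun d => d < v)).card < (D.filter (fun d => d < w)).card := by
        apply Finset.card_lt_card
        refine Finset.ssubset_iff_of_subset ?_ |>.mpr ⟨v, by simp [hvD, hvw], by simp⟩
        intro x hx
        simp only [Finset.mem_filter] at hx ⊢
        exact ⟨hx.1, hx.2.trans hvw⟩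
      omega
    · have := pos_of_mem_right h hwU; omega

theorem pos_lt_of_mem (h : IsLabelSplit n D U) {v w : ℕ} (hvw : v < w) (hw : w ≤ n + 2)
    (hv : v ∈ U) : pos n D U w < pos n D U v := by
  have hwc : w = n + 2 ∨ w ∈ D ∨ w ∈ U := by
    have := h.mem_or w
    by_cases hw2 : w = n + 2
    · exact Or.inl hw2
    · exact Or.inr (this.mpr (by omega))
  have h1 := pos_of_mem_right h hv
  rcases hwc with rfl | hwD | hwU
  · rw [pos_last]; omega
  · have := pos_of_mem_left h hwD; omega
  · have h2 := pos_of_mem_right h hwU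
    have : (U.filter (fun u => w < u)).card < (U.filter (fun u => v < u)).card := by
      apply Finset.card_lt_card
      refine Finset.ssubset_iff_of_subset ?_ |>.mpr ⟨w, by simp [hwU, hvw], by simp⟩
      intro x hx
      simp only [Finset.mem_filter] at hx ⊢
      exact ⟨hx.1, hvw.trans hx.2⟩
    omega

theorem pos_injOn (h : IsLabelSplit n D U) :
    Set.InjOn (pos n D U) (Finset.range (n + 3) : Set ℕ) := by
  intro v hv w hw hvw
  simp only [Finset.coe_range, Set.mem_Iio] at hv hw
  by_contra hne
  rcases Nat.lt_or_gt_of_ne hne with hlt | hlt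
  · by_cases hU : v ∈ U
    · have := pos_lt_of_mem h hlt (by omega) hU; omega
    · have := pos_lt_of_notMem h hlt (by omega) hU; omega
  · by_cases hU : w ∈ U
    · have := pos_lt_of_mem h hlt (by omega) hU; omega
    · have := pos_lt_of_notMem h hlt (by omega) hU; omega

theorem exists_pos_eq (h : IsLabelSplit n D U) {m : ℕ} (hm : m ≤ n + 2) :
    ∃ v ≤ n + 2, pos n D U v = m := by
  have himg : (Finset.range (n + 3)).image (pos n D U) = Finset.range (n + 3) := by
    apply Finset.eq_of_subset_of_card_le
    · intro x hx
      obtain ⟨v, hv, rfl⟩ := Finset.mem_image.mp hx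
      have := pos_le h (v := v) (by simp at hv; omega)
      simp; omega
    · rw [Finset.card_image_of_injOn (pos_injOn h)]
  have : m ∈ (Finset.range (n + 3)).image (pos n D U) := by
    rw [himg]; simp; omega
  obtain ⟨v, hv, rfl⟩ := Finset.mem_image.mp this
  exact ⟨v, by simp at hv; omega, rfl⟩

theorem relpos_eq (h : IsLabelSplit n D U) {a v : ℕ} (ha : a ≤ n + 2) (hv : v ≤ n + 2) :
    relpos n D U a v = if pos n D U a ≤ pos n D U v then pos n D U v - pos n D U a
      else pos n D U v + (n + 3) - pos n D U a := by
  have hpa := pos_le h ha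
  have hpv := pos_le h hv
  unfold relpos
  split_ifs with hle
  · rw [show pos n D U v + (n + 3) - pos n D U a = (pos n D U v - pos n D U a) + (n + 3) by omega,
      Nat.add_mod_right, Nat.mod_eq_of_lt (by omega)]
  · rw [Nat.mod_eq_of_lt (by omega)]

theorem strictBetween_iff_pos (h : IsLabelSplit n D U) {a b : ℕ} (ha : a ≤ n + 2)
    (hb : b ≤ n + 2) (v : ℕ) : StrictBetween n D U a b v ↔ v ≤ n + 2 ∧
      ((pos n D U a < pos n D U v ∧ pos n D U v < pos n D U b) ∨
       (pos n D U v < pos n D U b ∧ pos n D U b < pos n D U a) ∨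
       (pos n D U b < pos n D U a ∧ pos n D U a < pos n D U v)) := by
  have hpa := pos_le h ha
  have hpb := pos_le h hb
  unfold StrictBetween
  refine and_congr_right fun hv => ?_
  have hpv := pos_le h hv
  rw [relpos_eq h ha hv, relpos_eq h ha hb]
  split_ifs <;> omega

theorem strictBetween_iff_under (h : IsLabelSplit n D U) {a b v : ℕ} (hab : a < b)
    (hb : b ≤ n + 2) (hv : v ≤ n + 2) : StrictBetween n D U a b v ↔ Under D U a b v := by
  rw [strictBetween_iff_pos h (by omega) hb]
  have hpab := @pos_lt_of_notMem n D U h a b hab hb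
  have hpab' := @pos_lt_of_mem n D U h a b hab hb
  have hm := h.mem_or v
  have hd := h.notMem v
  unfold Under
  rcases lt_trichotomy v a with hva | rfl | hva
  · have h1 := @pos_lt_of_notMem n D U h v a hva (by omega)
    have h2 := @pos_lt_of_mem n D U h v a hva (by omega)
    have h3 := @pos_lt_of_notMem n D U h v b (by omega) (by omega)
    have h4 := @pos_lt_of_mem n D U h v b (by omega) (by omega)
    by_cases hvU : v ∈ U <;> by_cases haU : a ∈ U <;> simp_all <;> omega
  · by_cases haU : v ∈ U <;> simp_all <;> omega
  · rcases lt_trichotomy v b with hvb | rfl | hvb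
    · have h1 := @pos_lt_of_notMem n D U h a v hva (by omega)
      have h2 := @pos_lt_of_mem n D U h a v hva (by omega)
      have h3 := @pos_lt_of_notMem n D U h v b (by omega) (by omega)
      have h4 := @pos_lt_of_mem n D U h v b (by omega) (by omega)
      have hm' : v ∈ D ↔ v ∉ U := ⟨hd, fun hn => (hm.mpr (by omega)).resolve_right hn⟩
      rw [hm']
      by_cases hvU : v ∈ U <;> by_cases haU : a ∈ U <;> simp_all <;> omega
    · by_cases haU : a ∈ U <;> simp_all <;> omega
    · have h1 := @pos_lt_of_notMem n D U h a v hva (by omega)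
      have h2 := @pos_lt_of_mem n D U h a v hva (by omega)
      have h3 := @pos_lt_of_notMem n D U h b v (by omega) (by omega)
      have h4 := @pos_lt_of_mem n D U h b v (by omega) (by omega)
      by_cases hbU : b ∈ U <;> by_cases haU : a ∈ U <;> simp_all <;> omega

theorem strictBetween_rev (h : IsLabelSplit n D U) (a b v : ℕ) (ha : a ≤ n + 2) (hb : b ≤ n + 2)
    (hab : a ≠ b) :
    StrictBetween n D U b a v ↔ v ≤ n + 2 ∧ v ≠ a ∧ v ≠ b ∧ ¬ StrictBetween n D U a b v := by
  rw [strictBetween_iff_pos h hb ha, strictBetween_iff_pos h ha hb]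
  have key : ∀ x y, x ≤ n + 2 → y ≤ n + 2 → (x = y ↔ pos n D U x = pos n D U y) := fun x y hx hy =>
    ⟨fun e => by rw [e], fun e => pos_injOn h (by simp; omega) (by simp; omega) e⟩
  by_cases hv : v ≤ n + 2
  · have h1 := key v a hv ha
    have h2 := key v b hv hb
    have h3 := key a b ha hb
    omega
  · omega

theorem under_swap (h : IsLabelSplit n D U) {a b v : ℕ} (hab : a < b) (hb : b ≤ n + 2)
    (hv : v ≤ n + 2) : Under U D a b v ↔ v ≠ a ∧ v ≠ b ∧ ¬ Under D U a b v := by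
  have hma := h.mem_or a
  have hmb := h.mem_or b
  have hmv := h.mem_or v
  have hda := h.notMem a
  have hdb := h.notMem b
  have hdv := h.notMem v
  unfold Under
  rcases lt_trichotomy v a with hva | rfl | hva
  · grind
  · grind
  · rcases lt_trichotomy v b with hvb | rfl | hvb
    · grind
    · grind
    · grind

theorem strictBetween_rev_iff_under (h : IsLabelSplit n D U) {a b v : ℕ} (hab : a < b)
    (hb : b ≤ n + 2) (hv : v ≤ n + 2) : StrictBetween n D U b a v ↔ Under U D a b v := by
  rw [strictBetween_rev h a b v (by omega) hb (by omega), under_swap h hab hb hv,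
    strictBetween_iff_under h hab hb hv]
  exact and_iff_right hv

theorem strictBetween_swap (h : IsLabelSplit n D U) {a b : ℕ} (v : ℕ) (ha : a ≤ n + 2)
    (hb : b ≤ n + 2) (hab : a ≠ b) : StrictBetween n U D a b v ↔ StrictBetween n D U b a v := by
  by_cases hv : v ≤ n + 2
  · rcases Nat.lt_or_gt_of_ne hab with hlt | hlt
    · rw [strictBetween_iff_under h.symm hlt hb hv, strictBetween_rev_iff_under h hlt hb hv]
    · rw [strictBetween_rev_iff_under h.symm hlt ha hv, strictBetween_iff_under h hlt ha hv]
  · exact ⟨fun h' => absurd h'.1 hv, fun h' => absurd h'.1 hv⟩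

theorem relpos_eq_one_iff (h : IsLabelSplit n D U) {a b : ℕ} (ha : a ≤ n + 2) (hb : b ≤ n + 2)
    (hab : a ≠ b) : relpos n D U a b = 1 ↔ ∀ v, ¬ StrictBetween n D U a b v := by
  constructor
  · intro h1 v hv
    have := hv.2
    omega
  · intro hv
    have hpa := pos_le h ha
    have hpb := pos_le h hb
    have hne : pos n D U a ≠ pos n D U b := fun e =>
      hab (pos_injOn h (by simp; omega) (by simp; omega) e)
    by_cases hlast : pos n D U a = n + 2
    · obtain ⟨w, hw, hpw⟩ := exists_pos_eq h (Nat.zero_le (n + 2))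
      have := hv w
      rw [strictBetween_iff_pos h ha hb] at this
      rw [relpos_eq h ha hb]
      split_ifs <;> omega
    · obtain ⟨w, hw, hpw⟩ := exists_pos_eq h (m := pos n D U a + 1) (by omega)
      have := hv w
      rw [strictBetween_iff_pos h ha hb] at this
      rw [relpos_eq h ha hb]
      split_ifs <;> omega

theorem isBoundaryEdge_iff (h : IsLabelSplit n D U) {a b : ℕ} :
    IsBoundaryEdge n D U (a, b) ↔ a < b ∧ b ≤ n + 2 ∧
      ((∀ v ≤ n + 2, ¬ Under D U a b v) ∨ (∀ v ≤ n + 2, ¬ Under U D a b v)) := by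
  unfold IsBoundaryEdge IsDiag
  simp only [and_assoc]
  refine and_congr_right fun hab => and_congr_right fun hb => ?_
  rw [relpos_eq_one_iff h (by omega) hb (by omega), relpos_eq_one_iff h hb (by omega) (by omega)]
  refine or_congr (forall_congr' fun v => ?_) (forall_congr' fun v => ?_)
  · constructor
    · intro hn hv hu
      exact hn ((strictBetween_iff_under h hab hb hv).mpr hu)
    · intro hn hs
      exact hn hs.1 ((strictBetween_iff_under h hab hb hs.1).mp hs)
  · constructor
    · intro hn hv hu
      exact hn ((strictBetween_rev_iff_under h hab hb hv).mpr hu)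
    · intro hn hs
      exact hn hs.1 ((strictBetween_rev_iff_under h hab hb hs.1).mp hs)

theorem mem_bel_iff (h : IsLabelSplit n D U) {a b : ℕ} (hab : a < b) (hb : b ≤ n + 2) (j : ℕ) :
    j ∈ Bel n D U (a, b) ↔ (1 ≤ j ∧ j ≤ n + 1) ∧
      ((j ≤ a ∧ a ∈ U) ∨ (a < j ∧ j < b ∧ j ∈ D) ∨ (b ≤ j ∧ b ∈ U)) := by
  unfold Bel
  rw [Finset.mem_filter, Finset.mem_Icc]
  refine and_congr_right fun hj => ?_
  rw [strictBetween_iff_under h hab hb (by omega)]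
  unfold Under
  simp only
  have := h.notMem j
  grind

end Positions
section Edges

variable {n : ℕ} {D U : Finset ℕ} {T : Finset (ℕ × ℕ)}

theorem EdgeOf.bounds (hT : IsTriangulation n D U T) {a b : ℕ} (e : EdgeOf n D U T a b) :
    a < b ∧ b ≤ n + 2 := by
  rcases e with e | e
  · exact (hT.1 _ e).1
  · exact e.1

theorem EdgeOf.not_separated (h : IsLabelSplit n D U) (hT : IsTriangulation n D U T)
    {a b c d : ℕ} (e : EdgeOf n D U T a b) (e' : EdgeOf n D U T c d) :
    ¬ ((StrictBetween n D U a b c ∧ StrictBetween n D U b a d) ∨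
       (StrictBetween n D U a b d ∧ StrictBetween n D U b a c)) := by
  intro hc
  obtain ⟨hab, hb⟩ := e.bounds hT
  obtain ⟨hcd, hd⟩ := e'.bounds hT
  have ha : a ≤ n + 2 := by omega
  have hc' : c ≤ n + 2 := by omega
  rcases e with e | e
  · rcases e' with e' | e'
    · refine hT.2.1 _ e _ e' ⟨hab.ne, hcd.ne, ?_, ?_, ?_, ?_, hc⟩ <;> rintro heq <;>
        simp only at heq <;> subst heq <;> simp only [strictBetween_iff_pos h, ha, hb, hd, hc',
          true_and] at hc <;> omega
    · have hn := e'.2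
      simp only at hn
      rw [relpos_eq_one_iff h hc' hd hcd.ne, relpos_eq_one_iff h hd hc' hcd.ne'] at hn
      rcases hn with hn | hn
      · have h1 := hn a
        have h2 := hn b
        simp only [strictBetween_iff_pos h, ha, hb, hd, hc', true_and] at hc h1 h2
        omega
      · have h1 := hn a
        have h2 := hn b
        simp only [strictBetween_iff_pos h, ha, hb, hd, hc', true_and] at hc h1 h2
        omega
  · have hn := e.2
    simp only at hn
    rw [relpos_eq_one_iff h ha hb hab.ne, relpos_eq_one_iff h hb ha hab.ne'] at hn
    rcases hn with hn | hn
    · exact hc.elim (fun p => hn _ p.1) (fun p => hn _ p.1)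
    · exact hc.elim (fun p => hn _ p.2) (fun p => hn _ p.2)

/-- Two edges of a triangulation do not cross, in terms of labels. -/
theorem EdgeOf.not_under (h : IsLabelSplit n D U) (hT : IsTriangulation n D U T)
    {a b c d x y : ℕ} (e : EdgeOf n D U T a b) (e' : EdgeOf n D U T c d)
    (hx : Under D U a b x) (hy : Under U D a b y)
    (hxy : (x = c ∧ y = d) ∨ (x = d ∧ y = c)) : False := by
  obtain ⟨hab, hb⟩ := e.bounds hT
  obtain ⟨hcd, hd⟩ := e'.bounds hT
  apply e.not_separated h hT e'
  rcases hxy with ⟨rfl, rfl⟩ | ⟨rfl, rfl⟩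
  · exact Or.inl ⟨(strictBetween_iff_under h hab hb (by omega)).mpr hx,
      (strictBetween_rev_iff_under h hab hb hd).mpr hy⟩
  · exact Or.inr ⟨(strictBetween_iff_under h hab hb hd).mpr hx,
      (strictBetween_rev_iff_under h hab hb (by omega)).mpr hy⟩

/-- `x` and `y` are joined by an edge of `T`, in either order. -/
def Joined (n : ℕ) (D U : Finset ℕ) (T : Finset (ℕ × ℕ)) (x y : ℕ) : Prop :=
  EdgeOf n D U T x y ∨ EdgeOf n D U T y x

theorem Joined.symm {x y : ℕ} (e : Joined n D U T x y) : Joined n D U T y x := Or.symm e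

theorem Joined.le (hT : IsTriangulation n D U T) {x y : ℕ} (e : Joined n D U T x y) :
    x ≤ n + 2 ∧ y ≤ n + 2 := by
  rcases e with e | e <;> have := e.bounds hT <;> omega

theorem Joined.edgeOf (hT : IsTriangulation n D U T) {x y : ℕ} (e : Joined n D U T x y)
    (hxy : x < y) : EdgeOf n D U T x y := by
  rcases e with e | e
  · exact e
  · have := e.bounds hT; omega

theorem Joined.not_separated (h : IsLabelSplit n D U) (hT : IsTriangulation n D U T)
    {x y z w : ℕ} (e : Joined n D U T x y) (e' : Joined n D U T z w)
    (hz : StrictBetween n D U x y z) (hw : StrictBetween n D U y x w) : False := by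
  rcases e with e | e <;> rcases e' with e' | e'
  · exact e.not_separated h hT e' (Or.inl ⟨hz, hw⟩)
  · exact e.not_separated h hT e' (Or.inr ⟨hz, hw⟩)
  · exact e.not_separated h hT e' (Or.inr ⟨hw, hz⟩)
  · exact e.not_separated h hT e' (Or.inl ⟨hw, hz⟩)

theorem exists_separated_of_not_edgeOf (hT : IsTriangulation n D U T)
    {x y : ℕ} (hxy : x < y) (hy : y ≤ n + 2) (he : ¬ EdgeOf n D U T x y) :
    ∃ z w, Joined n D U T z w ∧ StrictBetween n D U x y z ∧ StrictBetween n D U y x w := by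
  have hb : ¬ IsBoundaryEdge n D U (x, y) := fun hb => he (Or.inr hb)
  obtain ⟨⟨c, d⟩, hδ, hc⟩ := hT.2.2 (x, y) ⟨⟨hxy, hy⟩, hb⟩ (fun hm => he (Or.inl hm))
  rcases hc.2.2.2.2.2.2 with hc | hc
  · exact ⟨c, d, Or.inl (Or.inl hδ), hc.1, hc.2⟩
  · exact ⟨d, c, Or.inr (Or.inl hδ), hc.1, hc.2⟩

theorem exists_separated_of_not_joined (hT : IsTriangulation n D U T)
    {x y : ℕ} (hxy : x ≠ y) (hx : x ≤ n + 2) (hy : y ≤ n + 2) (he : ¬ Joined n D U T x y) :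
    ∃ z w, Joined n D U T z w ∧ StrictBetween n D U x y z ∧ StrictBetween n D U y x w := by
  rcases Nat.lt_or_gt_of_ne hxy with hlt | hlt
  · exact exists_separated_of_not_edgeOf hT hlt hy fun e => he (Or.inl e)
  · obtain ⟨z, w, e, hz, hw⟩ := exists_separated_of_not_edgeOf hT hlt hx fun e => he (Or.inr e)
    exact ⟨w, z, e.symm, hw, hz⟩

/-- Every edge with a vertex strictly inside its counterclockwise arc is the side of a
triangle whose apex lies strictly inside that arc. -/
theorem Joined.exists_apex (h : IsLabelSplit n D U) (hT : IsTriangulation n D U T) {a b : ℕ}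
    (hab : a ≠ b) (e : Joined n D U T a b) (hne : ∃ v, StrictBetween n D U a b v) :
    ∃ c, StrictBetween n D U a b c ∧ Joined n D U T a c ∧ Joined n D U T c b := by
  obtain ⟨ha, hb⟩ := e.le hT
  have hpos : ∀ x y, x ≤ n + 2 → y ≤ n + 2 → pos n D U x = pos n D U y → x = y :=
    fun x y hx hy e => pos_injOn h (by simp; omega) (by simp; omega) e
  let S := (Finset.range (n + 3)).filter fun v => StrictBetween n D U a b v
  have hS : ∀ v, v ∈ S ↔ StrictBetween n D U a b v := fun v => by
    simp only [S, Finset.mem_filter, Finset.mem_range, and_iff_right_iff_imp]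
    intro hv
    have := hv.1
    omega
  obtain ⟨v, hv⟩ := hne
  obtain ⟨s, hs, hmin⟩ := S.exists_min_image (relpos n D U a) ⟨v, (hS v).mpr hv⟩
  have hs := (hS s).mp hs
  have hpa := pos_le h ha
  have hpb := pos_le h hb
  have hnabs : ∀ z, ¬ StrictBetween n D U a s z := fun z hz => by
    have h1 := hz.2
    have := hmin z ((hS z).mpr ⟨hz.1, by have := hs.2; omega⟩)
    omega
  have has : Joined n D U T a s := by
    by_contra hn
    have hne : a ≠ s := by
      rintro rfl
      have := hs.2
      rw [relpos_eq h ha ha] at this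
      simp at this
    obtain ⟨z, w, -, hz, -⟩ := exists_separated_of_not_joined hT hne ha hs.1 hn
    exact hnabs z hz
  obtain ⟨c, hc, hmax⟩ := (S.filter fun v => Joined n D U T a v).exists_max_image
    (relpos n D U a) ⟨s, by simp [hS, hs, has]⟩
  simp only [Finset.mem_filter, hS] at hc hmax
  refine ⟨c, hc.1, hc.2, ?_⟩
  by_contra hn
  have hcn := hc.1.1
  have hcb : c ≠ b := by
    rintro rfl
    have := hc.1.2
    omega
  obtain ⟨z, w, ezw, hz, hw⟩ := exists_separated_of_not_joined hT hcb hcn hb hn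
  have hac := hc.1
  have hzn := hz.1
  have hwn := hw.1
  have hpc := pos_le h hcn
  have hpz := pos_le h hzn
  have hz' := (strictBetween_iff_pos h hcn hb z).mp hz
  have hw' := (strictBetween_iff_pos h hb hcn w).mp hw
  have hac' := (strictBetween_iff_pos h ha hb c).mp hac
  have hzab : StrictBetween n D U a b z := by
    rw [strictBetween_iff_pos h ha hb]
    exact ⟨hzn, by omega⟩
  have hwa : w ≠ a := by
    rintro rfl
    have e3 := hmax z ⟨hzab, ezw.symm⟩
    rw [relpos_eq h ha hzn, relpos_eq h ha hcn] at e3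
    split_ifs at e3 <;> omega
  have hwa' : pos n D U w ≠ pos n D U a := fun e => hwa (hpos w a hwn ha e)
  by_cases hwb : StrictBetween n D U b a w
  · exact e.not_separated h hT ezw hzab hwb
  · refine hc.2.not_separated h hT ezw.symm (z := w) (w := z) ?_ ?_
    · rw [strictBetween_iff_pos h hb ha] at hwb
      rw [strictBetween_iff_pos h ha hcn]
      exact ⟨hwn, by omega⟩
    · rw [strictBetween_iff_pos h hcn ha]
      exact ⟨hzn, by omega⟩

theorem EdgeOf.exists_apex_under (h : IsLabelSplit n D U) (hT : IsTriangulation n D U T) {a b : ℕ}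
    (e : EdgeOf n D U T a b) {v : ℕ} (hv : v ≤ n + 2) (hu : Under D U a b v) :
    ∃ c, Under D U a b c ∧ Joined n D U T a c ∧ Joined n D U T c b := by
  obtain ⟨hab, hb⟩ := e.bounds hT
  obtain ⟨c, hc, h1, h2⟩ := Joined.exists_apex h hT hab.ne (Or.inl e)
    ⟨v, (strictBetween_iff_under h hab hb hv).mpr hu⟩
  exact ⟨c, (strictBetween_iff_under h hab hb hc.1).mp hc, h1, h2⟩

end Edges

section Reflection

variable {n : ℕ} {D U : Finset ℕ}

theorem isBoundaryEdge_swap (h : IsLabelSplit n D U) (δ : ℕ × ℕ) :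
    IsBoundaryEdge n U D δ ↔ IsBoundaryEdge n D U δ := by
  obtain ⟨a, b⟩ := δ
  rw [isBoundaryEdge_iff h, isBoundaryEdge_iff h.symm, or_comm]

theorem edgeOf_swap (h : IsLabelSplit n D U) (T : Finset (ℕ × ℕ)) (a b : ℕ) :
    EdgeOf n U D T a b ↔ EdgeOf n D U T a b := by
  unfold EdgeOf
  rw [isBoundaryEdge_swap h]

theorem isTriangleOf_swap (h : IsLabelSplit n D U) (T : Finset (ℕ × ℕ)) (i j k : ℕ) :
    IsTriangleOf n U D T i j k ↔ IsTriangleOf n D U T i j k := by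
  unfold IsTriangleOf
  simp only [edgeOf_swap h]

theorem isInternalDiag_swap (h : IsLabelSplit n D U) (δ : ℕ × ℕ) :
    IsInternalDiag n U D δ ↔ IsInternalDiag n D U δ := by
  unfold IsInternalDiag
  rw [isBoundaryEdge_swap h]

theorem cross_swap (h : IsLabelSplit n D U) {δ δ' : ℕ × ℕ} (hδ : IsDiag n δ) :
    Cross n U D δ δ' ↔ Cross n D U δ δ' := by
  have h1 : δ.1 < δ.2 := hδ.1
  have h2 : δ.2 ≤ n + 2 := hδ.2
  unfold Cross
  simp only [strictBetween_swap h _ (show δ.1 ≤ n + 2 by omega) h2 h1.ne,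
    strictBetween_swap h _ h2 (show δ.1 ≤ n + 2 by omega) h1.ne']
  tauto

theorem IsTriangulation.swap (h : IsLabelSplit n D U) {T : Finset (ℕ × ℕ)}
    (hT : IsTriangulation n D U T) : IsTriangulation n U D T := by
  refine ⟨fun δ hδ => (isInternalDiag_swap h δ).mpr (hT.1 δ hδ), fun δ hδ δ' hδ' hc => ?_,
    fun δ hδ hn => ?_⟩
  · exact hT.2.1 δ hδ δ' hδ' ((cross_swap h (hT.1 δ hδ).1).mp hc)
  · obtain ⟨δ', h1, h2⟩ := hT.2.2 δ ((isInternalDiag_swap h δ).mp hδ) hn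
    exact ⟨δ', h1, (cross_swap h hδ.1).mpr h2⟩

theorem bel_swap (h : IsLabelSplit n D U) {a b : ℕ} (hab : a < b) (hb : b ≤ n + 2) :
    Bel n U D (a, b) = Finset.Icc 1 (n + 1) \ Bel n D U (a, b) := by
  ext j
  rw [Finset.mem_sdiff, mem_bel_iff h.symm hab hb, mem_bel_iff h hab hb, Finset.mem_Icc]
  have h1 := h.mem_or j
  have h2 := h.notMem j
  have h3 := h.mem_or a
  have h4 := h.notMem a
  have h5 := h.mem_or b
  have h6 := h.notMem b
  grind

theorem bel_subset (δ : ℕ × ℕ) : Bel n D U δ ⊆ Finset.Icc 1 (n + 1) := Finset.filter_subset _ _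

end Reflection

section Triangles

variable {n : ℕ} {D U : Finset ℕ} {T : Finset (ℕ × ℕ)}

theorem triangle_unique_of_mem_left (h : IsLabelSplit n D U) (hT : IsTriangulation n D U T)
    {i j k i' k' : ℕ} (hj : j ∈ D) (t : IsTriangleOf n D U T i j k)
    (t' : IsTriangleOf n D U T i' j k') : i = i' ∧ k = k' := by
  have hjU := h.notMem j hj
  have key : ∀ {i k i' k' : ℕ}, IsTriangleOf n D U T i j k → IsTriangleOf n D U T i' j k' →
      ¬ i < i' ∧ ¬ k < k' := by
    rintro i k i' k' ⟨hij, hjk, hk, e1, e2, e3⟩ ⟨hij', hjk', hk', e1', e2', e3'⟩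
    constructor
    · intro hlt
      by_cases hi : i' ∈ D
      · refine e1.not_under h hT e3' (x := i') (y := k') ?_ ?_ (by simp) <;> unfold Under <;> grind
      · have : i' ∈ U := ((h.mem_or i').mpr (by omega)).resolve_left hi
        refine e3.not_under h hT e1' (x := j) (y := i') ?_ ?_ (by simp) <;> unfold Under <;> grind
    · intro hlt
      by_cases hi : k ∈ D
      · refine e2'.not_under h hT e3 (x := k) (y := i) ?_ ?_ (by simp) <;> unfold Under <;> grind
      · have : k ∈ U := ((h.mem_or k).mpr (by omega)).resolve_left hi
        refine e3'.not_under h hT e2 (x := j) (y := k) ?_ ?_ (by simp) <;> unfold Under <;> grind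
  have h1 := key t t'
  have h2 := key t' t
  omega

theorem triangle_unique (h : IsLabelSplit n D U) (hT : IsTriangulation n D U T)
    {i j k i' k' : ℕ} (t : IsTriangleOf n D U T i j k)
    (t' : IsTriangleOf n D U T i' j k') : i = i' ∧ k = k' := by
  have hb := t.1
  have hb' := t.2.1
  have hb'' := t.2.2.1
  rcases (h.mem_or j).mpr (by omega) with hj | hj
  · exact triangle_unique_of_mem_left h hT hj t t'
  · exact triangle_unique_of_mem_left h.symm (hT.swap h) hj ((isTriangleOf_swap h ..).mpr t)
      ((isTriangleOf_swap h ..).mpr t')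

theorem xcoord_eq (h : IsLabelSplit n D U) (hT : IsTriangulation n D U T) {i j k : ℕ}
    (t : IsTriangleOf n D U T i j k) :
    xcoord n D U T j = if j ∈ D then ((bel n D U (i, j) : ℝ) + 1) * ((bel n D U (j, k) : ℝ) + 1)
      else ((n : ℝ) + 2) - (((n : ℝ) + 2) - (bel n D U (i, j) : ℝ)) *
          (((n : ℝ) + 2) - (bel n D U (j, k) : ℝ)) := by
  have hex : ∃ p : ℕ × ℕ, IsTriangleOf n D U T p.1 j p.2 := ⟨(i, k), t⟩
  obtain ⟨h1, h2⟩ := triangle_unique h hT t hex.choose_spec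
  unfold xcoord
  rw [dif_pos hex, ← h1, ← h2]

theorem bel_union_of_mem_left (h : IsLabelSplit n D U) {i j k : ℕ} (hij : i < j) (hjk : j < k)
    (hk : k ≤ n + 2) (hj : j ∈ D) :
    Bel n D U (i, k) = insert j (Bel n D U (i, j) ∪ Bel n D U (j, k)) ∧
      j ∉ Bel n D U (i, j) ∪ Bel n D U (j, k) ∧
      Disjoint (Bel n D U (i, j)) (Bel n D U (j, k)) := by
  have hjU := h.notMem j hj
  have hjm := (h.mem_or j).mp (Or.inl hj)
  refine ⟨?_, ?_, ?_⟩
  · ext v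
    rw [Finset.mem_insert, Finset.mem_union, mem_bel_iff h (by omega) hk,
      mem_bel_iff h hij (by omega), mem_bel_iff h hjk hk]
    grind
  · rw [Finset.mem_union, mem_bel_iff h hij (by omega), mem_bel_iff h hjk hk]
    grind
  · rw [Finset.disjoint_left]
    intro v
    rw [mem_bel_iff h hij (by omega), mem_bel_iff h hjk hk]
    grind

end Triangles
section Summation

variable {n : ℕ} {D U : Finset ℕ} {T : Finset (ℕ × ℕ)}

theorem sum_bel_of_mem_left {M : Type*} [AddCommMonoid M] (h : IsLabelSplit n D U) {i j k : ℕ}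
    (hij : i < j) (hjk : j < k) (hk : k ≤ n + 2) (hj : j ∈ D) (f : ℕ → M) :
    ∑ v ∈ Bel n D U (i, k), f v =
      f j + (∑ v ∈ Bel n D U (i, j), f v + ∑ v ∈ Bel n D U (j, k), f v) := by
  obtain ⟨h1, h2, h3⟩ := bel_union_of_mem_left h hij hjk hk hj
  rw [h1, Finset.sum_insert h2, Finset.sum_union h3]

theorem sum_bel_swap {M : Type*} [AddCommMonoid M] (h : IsLabelSplit n D U) {a b : ℕ}
    (hab : a < b) (hb : b ≤ n + 2) (f : ℕ → M) :
    ∑ v ∈ Bel n U D (a, b), f v + ∑ v ∈ Bel n D U (a, b), f v = ∑ v ∈ Finset.Icc 1 (n + 1), f v := by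
  rw [bel_swap h hab hb]
  exact Finset.sum_sdiff (bel_subset _)

theorem sum_bel_of_mem_right (h : IsLabelSplit n D U) {i j k : ℕ}
    (hij : i < j) (hjk : j < k) (hk : k ≤ n + 2) (hj : j ∈ U) (f : ℕ → ℝ) :
    ∑ v ∈ Bel n D U (i, j), f v + ∑ v ∈ Bel n D U (j, k), f v =
      f j + ∑ v ∈ Bel n D U (i, k), f v + ∑ v ∈ Finset.Icc 1 (n + 1), f v := by
  have h1 := sum_bel_of_mem_left h.symm hij hjk hk hj f
  have h2 := sum_bel_swap h hij (by omega) f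
  have h3 := sum_bel_swap h hjk hk f
  have h4 := sum_bel_swap h (hij.trans hjk) hk f
  linarith

/-- A superadditive edge potential bounds the sum of the triangle weights below an edge. -/
theorem potential_le_sum_bel (m : ℕ) : ∀ {D U : Finset ℕ}, IsLabelSplit n D U →
    IsTriangulation n D U T → ∀ {g : ℕ → ℕ → ℝ} {G : ℝ} {y : ℕ → ℝ},
    (∀ a b, EdgeOf n D U T a b → Bel n D U (a, b) = ∅ → g a b ≤ 0) →
    (∀ a b, EdgeOf n D U T a b → Bel n U D (a, b) = ∅ → G ≤ g a b) →
    (∀ i j k, IsTriangleOf n D U T i j k → j ∈ D → g i k ≤ y j + g i j + g j k) →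
    (∀ i j k, IsTriangleOf n D U T i j k → j ∈ U → g i j + g j k ≤ y j + g i k + G) →
    ∀ a b, EdgeOf n D U T a b → (Bel n D U (a, b)).card ≤ m →
      g a b ≤ ∑ v ∈ Bel n D U (a, b), y v := by
  induction m with
  | zero =>
    intro D U h hT g G y hlow hupp hD hU a b e hm
    have h0 : Bel n D U (a, b) = ∅ := Finset.card_eq_zero.mp (by omega)
    rw [h0, Finset.sum_empty]
    exact hlow a b e h0
  | succ m ih =>
    intro D U h hT g G y hlow hupp hD hU a b e hm
    obtain ⟨hab, hb⟩ := e.bounds hT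
    rcases Finset.eq_empty_or_nonempty (Bel n D U (a, b)) with h0 | ⟨v, hv⟩
    · rw [h0, Finset.sum_empty]
      exact hlow a b e h0
    · have hex : ∃ w ≤ n + 2, Under D U a b w := by
        rw [mem_bel_iff h hab hb] at hv
        unfold Under
        rcases hv with ⟨hv, hv' | hv' | hv'⟩
        · exact ⟨0, by omega, Or.inl ⟨by omega, hv'.2⟩⟩
        · exact ⟨v, by omega, Or.inr (Or.inl hv')⟩
        · exact ⟨n + 2, le_rfl, Or.inr (Or.inr ⟨by omega, hv'.2⟩)⟩
      obtain ⟨w, hw, hwu⟩ := hex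
      obtain ⟨c, hc, hac, hcb⟩ := e.exists_apex_under h hT hw hwu
      have ih1 := ih h hT hlow hupp hD hU
      have ih2 := ih h.symm (hT.swap h) (g := fun a b => G - g a b) (G := G) (y := y)
        (fun a b e h0 => by
          have := hupp a b ((edgeOf_swap h ..).mp e) h0
          linarith)
        (fun a b e h0 => by
          have := hlow a b ((edgeOf_swap h ..).mp e) h0
          linarith)
        (fun i j k t hj => by
          have := hU i j k ((isTriangleOf_swap h ..).mp t) hj
          linarith)
        (fun i j k t hj => by
          have := hD i j k ((isTriangleOf_swap h ..).mp t) hj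
          linarith)
      simp only [edgeOf_swap h] at ih2
      rcases hc with ⟨hca, haU⟩ | ⟨hac', hcb', hcD⟩ | ⟨hbc, hbU⟩
      · have e1 := hac.symm.edgeOf hT hca
        have e2 := hcb.edgeOf hT (by omega)
        have hsum : ∀ f : ℕ → ℝ, ∑ v ∈ Bel n D U (a, b), f v =
            f a + (∑ v ∈ Bel n U D (c, a), f v + ∑ v ∈ Bel n D U (c, b), f v) := fun f => by
          have h1 := sum_bel_of_mem_left h.symm hca hab hb haU f
          have h2 := sum_bel_swap h hab hb f
          have h3 := sum_bel_swap h (hca.trans hab) hb f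
          linarith
        have hcard := hsum fun _ => 1
        simp only [Finset.sum_const, nsmul_eq_mul, mul_one] at hcard
        norm_cast at hcard
        have i1 := ih1 c b e2 (by omega)
        have i2 := ih2 c a e1 (by omega)
        have := hU c a b ⟨hca, hab, hb, e1, e, e2⟩ haU
        rw [hsum]
        linarith
      · have e1 := hac.edgeOf hT hac'
        have e2 := hcb.edgeOf hT hcb'
        have hsum := fun f : ℕ → ℝ => sum_bel_of_mem_left h hac' hcb' hb hcD f
        have hcard := hsum fun _ => 1
        simp only [Finset.sum_const, nsmul_eq_mul, mul_one] at hcard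
        norm_cast at hcard
        have i1 := ih1 a c e1 (by omega)
        have i2 := ih1 c b e2 (by omega)
        have := hD a c b ⟨hac', hcb', hb, e1, e2, e⟩ hcD
        rw [hsum]
        linarith
      · have e1 := hac.edgeOf hT (by omega)
        have e2 := hcb.symm.edgeOf hT hbc
        have hcn := (e1.bounds hT).2
        have hsum : ∀ f : ℕ → ℝ, ∑ v ∈ Bel n D U (a, b), f v =
            f b + (∑ v ∈ Bel n U D (b, c), f v + ∑ v ∈ Bel n D U (a, c), f v) := fun f => by
          have h1 := sum_bel_of_mem_left h.symm hab hbc hcn hbU f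
          have h2 := sum_bel_swap h hab hb f
          have h3 := sum_bel_swap h (hab.trans hbc) hcn f
          linarith
        have hcard := hsum fun _ => 1
        simp only [Finset.sum_const, nsmul_eq_mul, mul_one] at hcard
        norm_cast at hcard
        have i1 := ih1 a c e1 (by omega)
        have i2 := ih2 b c e2 (by omega)
        have := hU a b c ⟨hab, hbc, hcn, e, e2, e1⟩ hbU
        rw [hsum]
        linarith

theorem potential_le_sum (h : IsLabelSplit n D U) (hT : IsTriangulation n D U T)
    {g : ℕ → ℕ → ℝ} {G : ℝ} {y : ℕ → ℝ}
    (hlow : ∀ a b, EdgeOf n D U T a b → Bel n D U (a, b) = ∅ → g a b ≤ 0)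
    (hupp : ∀ a b, EdgeOf n D U T a b → Bel n U D (a, b) = ∅ → G ≤ g a b)
    (hD : ∀ i j k, IsTriangleOf n D U T i j k → j ∈ D → g i k ≤ y j + g i j + g j k)
    (hU : ∀ i j k, IsTriangleOf n D U T i j k → j ∈ U → g i j + g j k ≤ y j + g i k + G)
    {a b : ℕ} (e : EdgeOf n D U T a b) (he : Bel n U D (a, b) = ∅) :
    G ≤ ∑ v ∈ Finset.Icc 1 (n + 1), y v := by
  obtain ⟨hab, hb⟩ := e.bounds hT
  rw [← sum_bel_swap h hab hb, he, Finset.sum_empty, zero_add]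
  exact (hupp a b e he).trans (potential_le_sum_bel _ h hT hlow hupp hD hU a b e le_rfl)

end Summation
section PrefixBound

variable {n : ℕ} {D U : Finset ℕ} {T : Finset (ℕ × ℕ)}

theorem sum_ite_le_Icc {p N : ℕ} (hp : p ≤ N) :
    ∑ v ∈ Finset.Icc 1 N, (if v ≤ p then (1 : ℝ) else 0) = p := by
  rw [← Finset.sum_filter, Finset.sum_const, nsmul_eq_mul, mul_one]
  have : (Finset.Icc 1 N).filter (· ≤ p) = Finset.Icc 1 p := by
    ext v
    simp only [Finset.mem_filter, Finset.mem_Icc]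
    omega
  rw [this, Nat.card_Icc]
  simp

theorem sum_bel_congr_of_le (h : IsLabelSplit n D U) {a b p : ℕ} (hab : a < b) (hb : b ≤ p)
    (hp : p ≤ n + 1) (hbU : b ∉ U) {f g : ℕ → ℝ} (hfg : ∀ v ≤ p, f v = g v) :
    ∑ v ∈ Bel n D U (a, b), f v = ∑ v ∈ Bel n D U (a, b), g v := by
  refine Finset.sum_congr rfl fun v hv => hfg v ?_
  rw [mem_bel_iff h hab (by omega)] at hv
  grind

/-- The triangular number `x (x + 1) / 2`. -/
def triangular (x : ℝ) : ℝ := x * (x + 1) / 2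

theorem triangular_add_le_sum_ite_xcoord (h : IsLabelSplit n D U) (hT : IsTriangulation n D U T)
    {p u : ℕ} (hp : p ≤ n + 1) (hu : 1 ≤ u) (hup : u ≤ p) {θ : ℝ} (hθ : 0 ≤ θ)
    (hs : ∀ a b, EdgeOf n D U T a b → a ≤ p → p < b →
      ∑ w ∈ Bel n D U (a, b), (if w = u then θ else 0) ≤
        (bel n D U (a, b) : ℝ) - ∑ w ∈ Bel n D U (a, b), (if w ≤ p then (1 : ℝ) else 0))
    {a b : ℕ} (e : EdgeOf n D U T a b) (he : Bel n U D (a, b) = ∅) :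
    triangular p + θ ≤ ∑ j ∈ Finset.Icc 1 (n + 1), (if j ≤ p then xcoord n D U T j else 0) := by
  have hbel : ∀ (D U : Finset ℕ) δ, (bel n D U δ : ℝ) = ∑ w ∈ Bel n D U δ, (1 : ℝ) :=
    fun D U δ => by simp [bel]
  set q : ℕ → ℝ := fun w => if w ≤ p then (1 : ℝ) else 0 with hq
  set s : ℕ → ℝ := fun w => if w = u then θ else 0 with hsdef
  have hone : ∑ w ∈ Finset.Icc 1 (n + 1), (1 : ℝ) = n + 1 := by simp
  have hqtot : ∑ w ∈ Finset.Icc 1 (n + 1), q w = p := sum_ite_le_Icc hp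
  have hstot : ∑ w ∈ Finset.Icc 1 (n + 1), s w = θ := by
    simp only [hsdef, Finset.sum_ite_eq', Finset.mem_Icc]
    rw [if_pos ⟨hu, by omega⟩]
  have hs0 : ∀ δ, 0 ≤ ∑ w ∈ Bel n D U δ, s w := fun δ =>
    Finset.sum_nonneg fun w _ => by simp only [hsdef]; split_ifs <;> simp [hθ]
  have hq1 : ∀ δ, ∑ w ∈ Bel n D U δ, q w ≤ bel n D U δ := fun δ => by
    rw [hbel]
    exact Finset.sum_le_sum fun w _ => by simp only [hq]; split_ifs <;> simp
  have hqle : ∀ v ≤ p, (1 : ℝ) = q v := fun v hv => by simp [hq, hv]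
  have hqgt : ∀ v, p < v → q v = 0 := fun v hv => by simp [hq, hv]
  have hsgt : ∀ v, p < v → s v = 0 := fun v hv => by simp only [hsdef]; rw [if_neg (by omega)]
  have hzero : ∀ {D U : Finset ℕ}, IsLabelSplit n D U → ∀ {f : ℕ → ℝ}, (∀ v, p < v → f v = 0) →
      ∀ {a b : ℕ}, a < b → b ≤ n + 2 → p < a → a ∉ U → ∑ v ∈ Bel n D U (a, b), f v = 0 := by
    intro D U h f hf a b hab hb ha haU
    refine Finset.sum_eq_zero fun v hv => hf v ?_
    rw [mem_bel_iff h hab hb] at hv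
    grind
  set g : ℕ → ℕ → ℝ := fun a b =>
    if b ≤ p then
      (if b ∈ U then triangular p + θ - triangular (n + 1) + triangular (bel n D U (a, b))
        else triangular (bel n D U (a, b)))
    else triangular (∑ w ∈ Bel n D U (a, b), q w) + ∑ w ∈ Bel n D U (a, b), s w with hg
  refine potential_le_sum h hT (g := g) ?_ ?_ ?_ ?_ e he
  · intro a b e h0
    obtain ⟨hab, hb⟩ := e.bounds hT
    have hbU : b ∉ U := fun hbU => by
      have : b ∈ Bel n D U (a, b) := by
        have := (h.mem_or b).mp (Or.inr hbU)
        rw [mem_bel_iff h hab hb]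
        exact ⟨this, Or.inr (Or.inr ⟨le_rfl, hbU⟩)⟩
      simp [h0] at this
    simp [hg, hbel, h0, hbU, triangular]
  · intro a b e h0
    obtain ⟨hab, hb⟩ := e.bounds hT
    have h1 := sum_bel_swap h hab hb fun _ => (1 : ℝ)
    have h2 := sum_bel_swap h hab hb q
    have h3 := sum_bel_swap h hab hb s
    rw [h0, Finset.sum_empty, zero_add] at h1 h2 h3
    rw [← hbel, hone] at h1
    rw [hqtot] at h2
    rw [hstot] at h3
    simp only [hg, h1, h2, h3]
    split_ifs with c1 c2
    · linarith
    · have hbD : b ∈ D := ((h.mem_or b).mpr (by omega)).resolve_right c2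
      have : b ∈ Bel n U D (a, b) := by
        rw [mem_bel_iff h.symm hab hb]
        exact ⟨by omega, Or.inr (Or.inr ⟨le_rfl, hbD⟩)⟩
      simp [h0] at this
    · exact le_rfl
  · intro i j k t hj
    rw [xcoord_eq h hT t, if_pos hj]
    obtain ⟨hij, hjk, hk, e1, e2, e3⟩ := t
    have hjU := h.notMem j hj
    have b1 := sum_bel_of_mem_left h hij hjk hk hj fun _ => (1 : ℝ)
    have b2 := sum_bel_of_mem_left h hij hjk hk hj q
    have b3 := sum_bel_of_mem_left h hij hjk hk hj s
    simp only [← hbel] at b1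
    simp only [hg]
    by_cases hjp : j ≤ p
    · have c1 := sum_bel_congr_of_le h hij hjp hp hjU hqle
      rw [← hbel] at c1
      rw [← hqle j hjp, ← c1] at b2
      by_cases hkp : k ≤ p
      · simp only [hjp, hkp, hjU, if_true, if_false, b1, triangular]
        split_ifs <;> linarith
      · have hs3 := hs i k e3 (by omega) (by omega)
        have hq2 := hq1 (j, k)
        have hs2 := hs0 (j, k)
        have hb0 : (0 : ℝ) ≤ bel n D U (i, j) := Nat.cast_nonneg _
        simp only [hjp, hkp, hjU, if_true, if_false, triangular]
        rw [b1] at hs3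
        rw [b2] at hs3 ⊢
        nlinarith [mul_nonneg hb0 (sub_nonneg.mpr hq2)]
    · have c2 := hzero h hqgt hjk hk (by omega) hjU
      have c3 := hzero h hsgt hjk hk (by omega) hjU
      rw [c2, hqgt j (by omega)] at b2
      rw [c3, hsgt j (by omega)] at b3
      have hkp : ¬ k ≤ p := by omega
      simp only [hjp, hkp, if_false, b2, b3, c2, c3, triangular]
      linarith
  · intro i j k t hj
    have hjD : j ∉ D := fun hjD => h.notMem j hjD hj
    rw [xcoord_eq h hT t, if_neg hjD]
    obtain ⟨hij, hjk, hk, e1, e2, e3⟩ := t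
    have b1 := sum_bel_of_mem_right h hij hjk hk hj fun _ => (1 : ℝ)
    have b2 := sum_bel_of_mem_right h hij hjk hk hj q
    have b3 := sum_bel_of_mem_right h hij hjk hk hj s
    rw [hone] at b1
    simp only [← hbel] at b1
    rw [hqtot] at b2
    rw [hstot] at b3
    simp only [hg]
    by_cases hjp : j ≤ p
    · have c1 := sum_bel_congr_of_le h.symm hij hjp hp hjD hqle
      have c2 := sum_bel_swap h hij (by omega) fun _ => (1 : ℝ)
      have c3 := sum_bel_swap h hij (by omega) q
      rw [hone] at c2
      rw [hqtot] at c3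
      rw [← hbel D U] at c2
      rw [← hqle j hjp] at b2
      by_cases hkp : k ≤ p
      · have e1 : (bel n D U (i, k) : ℝ) = bel n D U (i, j) + bel n D U (j, k) - n - 2 := by
          linarith
        simp only [hjp, hkp, hj, if_true, e1, triangular]
        split_ifs <;> linarith
      · have hs2 := hs j k e2 (by omega) (by omega)
        have hs3 := hs0 (i, k)
        have hd : (0 : ℝ) ≤ n + 1 - bel n D U (i, j) := by
          have : (0 : ℝ) ≤ ∑ v ∈ Bel n U D (i, j), (1 : ℝ) := by simp
          linarith
        have hq2 := hq1 (j, k)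
        have e1 : (bel n D U (i, k) : ℝ) = bel n D U (i, j) + bel n D U (j, k) - n - 2 := by
          linarith
        have e2 : ∑ v ∈ Bel n D U (i, k), q v =
            bel n D U (i, j) + ∑ v ∈ Bel n D U (j, k), q v - n - 2 := by
          linarith
        simp only [hjp, hkp, hj, if_true, if_false, e2, triangular]
        nlinarith [mul_nonneg hd (sub_nonneg.mpr hq2)]
    · have c2 := hzero h.symm hqgt hjk hk (by omega) hjD
      have c3 := hzero h.symm hsgt hjk hk (by omega) hjD
      have d2 := sum_bel_swap h hjk hk q
      have d3 := sum_bel_swap h hjk hk s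
      rw [c2, hqtot, zero_add] at d2
      rw [c3, hstot, zero_add] at d3
      rw [d2, hqgt j (by omega)] at b2
      rw [d3, hsgt j (by omega)] at b3
      have hkp : ¬ k ≤ p := by omega
      have e1 : ∑ v ∈ Bel n D U (i, k), q v = ∑ v ∈ Bel n D U (i, j), q v := by linarith
      simp only [hjp, hkp, if_false, e1, d2, d3, triangular]
      linarith

end PrefixBound

section MinDiag

variable {n : ℕ} {D U : Finset ℕ}

/-- `{a,b}` is the diagonal `δ_i`: its left endpoint is the last element of `U ∪ {0}` up to `i`,
its right endpoint the first element of `D ∪ {n+2}` after `i`. -/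
structure IsMinDiag (n : ℕ) (D U : Finset ℕ) (i a b : ℕ) : Prop where
  left_mem : a = 0 ∨ a ∈ U
  left_le : a ≤ i
  le_left : ∀ w ∈ U, w ≤ i → w ≤ a
  right_mem : b = n + 2 ∨ b ∈ D
  lt_right : i < b
  right_le : ∀ w ∈ D, i < w → b ≤ w
  right_le_last : b ≤ n + 2

theorem isMinDiag_minDiag (h : IsLabelSplit n D U) {i : ℕ} (hi : i ≤ n + 1) :
    IsMinDiag n D U i (minDiag n D U i).1 (minDiag n D U i).2 := by
  have h1 := Finset.max'_mem _ (Finset.insert_nonempty 0 (U ∩ Finset.Icc 1 i))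
  have h2 := Finset.min'_mem _ (Finset.insert_nonempty (n + 2) (D \ Finset.Icc 1 i))
  have h3 := Finset.le_max' (insert 0 (U ∩ Finset.Icc 1 i))
  have h4 := Finset.min'_le (insert (n + 2) (D \ Finset.Icc 1 i))
  change (minDiag n D U i).1 ∈ _ at h1
  change (minDiag n D U i).2 ∈ _ at h2
  simp only [Finset.mem_insert, Finset.mem_inter, Finset.mem_sdiff, Finset.mem_Icc] at h1 h2 h3 h4
  have hb := h.mem_or (minDiag n D U i).2
  refine ⟨?_, ?_, ?_, ?_, ?_, ?_, ?_⟩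
  · tauto
  · omega
  · intro w hw hwi
    have := (h.mem_or w).mp (Or.inr hw)
    exact h3 w (Or.inr ⟨hw, by omega⟩)
  · tauto
  · rcases h2 with h2 | h2
    · omega
    · have := hb.mp (Or.inl h2.1)
      omega
  · intro w hw hwi
    exact h4 w (Or.inr ⟨hw, by omega⟩)
  · exact h4 _ (Or.inl rfl)

theorem IsMinDiag.unique {i a b a' b' : ℕ} (m : IsMinDiag n D U i a b)
    (m' : IsMinDiag n D U i a' b') : a = a' ∧ b = b' := by
  obtain ⟨h1, h2, h3, h4, h5, h6, h7⟩ := m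
  obtain ⟨h1', h2', h3', h4', h5', h6', h7'⟩ := m'
  grind

theorem IsMinDiag.eq (h : IsLabelSplit n D U) {i a b : ℕ} (hi : i ≤ n + 1)
    (m : IsMinDiag n D U i a b) : minDiag n D U i = (a, b) := by
  obtain ⟨h1, h2⟩ := (isMinDiag_minDiag h hi).unique m
  exact Prod.ext h1 h2

theorem bel_minDiag (h : IsLabelSplit n D U) {i : ℕ} (hi : i ≤ n + 1) :
    Bel n D U (minDiag n D U i) = Finset.Icc 1 i := by
  obtain ⟨h1, h2, h3, h4, h5, h6, h7⟩ := isMinDiag_minDiag h hi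
  generalize (minDiag n D U i) = δ at *
  obtain ⟨a, b⟩ := δ
  ext v
  simp only at *
  rw [mem_bel_iff h (by omega) h7, Finset.mem_Icc]
  have hv := h.mem_or v
  have hb := h.notMem b
  have hbb := h.mem_or b
  have hd := h.notMem v
  have h3v := h3 v
  have h6v := h6 v
  grind

theorem isInternalDiag_minDiag (h : IsLabelSplit n D U) {i : ℕ} (h0 : 1 ≤ i) (hi : i ≤ n) :
    IsInternalDiag n D U (minDiag n D U i) := by
  obtain ⟨h1, h2, h3, h4, h5, h6, h7⟩ := isMinDiag_minDiag h (show i ≤ n + 1 by omega)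
  generalize (minDiag n D U i) = δ at *
  obtain ⟨a, b⟩ := δ
  simp only at *
  refine ⟨⟨show a < b by omega, h7⟩, fun hb => ?_⟩
  rw [isBoundaryEdge_iff h] at hb
  rcases hb.2.2 with hn | hn
  · rcases h1 with rfl | haU
    · have h11 : 1 ∈ D := by
        rcases (h.mem_or 1).mpr (by omega) with hD | hU
        · exact hD
        · have := h3 1 hU h0; omega
      exact hn 1 (by omega) (Or.inr (Or.inl ⟨by omega, by omega, h11⟩))
    · have := (h.mem_or a).mp (Or.inr haU)
      exact hn 0 (by omega) (Or.inl ⟨by omega, haU⟩)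
  · rcases h4 with rfl | hbD
    · have h11 : n + 1 ∈ U := by
        rcases (h.mem_or (n + 1)).mpr (by omega) with hD | hU
        · have := h6 _ hD (by omega); omega
        · exact hU
      exact hn (n + 1) (by omega) (Or.inr (Or.inl ⟨by omega, by omega, h11⟩))
    · have := (h.mem_or b).mp (Or.inl hbD)
      exact hn (n + 2) (by omega) (Or.inr (Or.inr ⟨by omega, hbD⟩))

theorem IsMinDiag.not_cross (h : IsLabelSplit n D U) {i j a b c d : ℕ} (m : IsMinDiag n D U i a b)
    (m' : IsMinDiag n D U j c d) : ¬ Cross n D U (a, b) (c, d) := by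
  rintro ⟨-, -, hac, had, hbc, hbd, hc⟩
  obtain ⟨h1, h2, h3, h4, h5, h6, h7⟩ := m
  obtain ⟨h1', h2', h3', h4', h5', h6', h7'⟩ := m'
  simp only at hac had hbc hbd hc
  rw [strictBetween_iff_under h (by omega) h7 (by omega),
    strictBetween_iff_under h (by omega) h7 (by omega),
    strictBetween_rev_iff_under h (by omega) h7 (by omega),
    strictBetween_rev_iff_under h (by omega) h7 (by omega)] at hc
  unfold Under at hc
  have hda := h.notMem a
  have hdb := h.notMem b
  have hdc := h.notMem c
  have hdd := h.notMem d
  have ma := h.mem_or a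
  have mb := h.mem_or b
  have mc := h.mem_or c
  have md := h.mem_or d
  grind

theorem cross_of_under (h : IsLabelSplit n D U) {a b c d x y : ℕ} (hab : a < b) (hb : b ≤ n + 2)
    (hcd : c < d) (hd : d ≤ n + 2) (hx : Under D U a b x) (hy : Under U D a b y)
    (hxy : (x = c ∧ y = d) ∨ (x = d ∧ y = c)) : Cross n D U (c, d) (a, b) := by
  have hxn : x ≤ n + 2 := by omega
  have hyn : y ≤ n + 2 := by omega
  have hc : c ≤ n + 2 := by omega
  have ha : a ≤ n + 2 := by omega
  rw [← strictBetween_iff_under h hab hb hxn] at hx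
  rw [← strictBetween_rev_iff_under h hab hb hyn] at hy
  unfold Cross
  simp only [strictBetween_iff_pos h, hc, hd, ha, hb, hxn, hyn, true_and] at hx hy ⊢
  refine ⟨hcd.ne, hab.ne, ?_, ?_, ?_, ?_, ?_⟩
  any_goals rintro rfl; rcases hxy with ⟨rfl, rfl⟩ | ⟨rfl, rfl⟩ <;> omega
  rcases hxy with ⟨rfl, rfl⟩ | ⟨rfl, rfl⟩ <;> omega

theorem exists_isMinDiag_under (h : IsLabelSplit n D U) {c d v w : ℕ} (hcd : c < d) (hd : d ≤ n + 2)
    (hv : Under D U c d v) (hw : Under U D c d w)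
    (hne : ∀ i, 1 ≤ i → i ≤ n → ¬ IsMinDiag n D U i c d) :
    ∃ i, 1 ≤ i ∧ i ≤ n ∧ ∀ a b, IsMinDiag n D U i a b → Under D U a b c ∧ Under U D a b d := by
  have mc := h.mem_or c
  have md := h.mem_or d
  have mv := h.mem_or v
  have mw := h.mem_or w
  have dc := h.notMem c
  have dd := h.notMem d
  unfold Under at *
  by_cases hdU : d ∈ U
  · have key : ∀ i, i < d → ∀ a b, IsMinDiag n D U i a b →
        (a < d ∧ d < b ∧ d ∈ U) ∨ (b < d ∧ b ∈ D) := by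
      intro i hi a b m
      have ha := m.left_le
      have hb := m.right_mem
      have hbd : b ≠ d := by
        rintro rfl
        rcases hb with hb | hb
        · have := md.mp (Or.inr hdU)
          omega
        · exact h.notMem _ hb hdU
      have := md.mp (Or.inr hdU)
      rcases lt_or_gt_of_ne hbd with hlt | hlt
      · exact Or.inr ⟨hlt, hb.resolve_left (by omega)⟩
      · exact Or.inl ⟨by omega, hlt, hdU⟩
    by_cases hcD : c ∈ D
    · refine ⟨c, by have := mc.mp (Or.inl hcD); omega, by have := md.mp (Or.inr hdU); omega,
        fun a b m => ⟨Or.inr (Or.inl ⟨?_, m.lt_right, hcD⟩), Or.inr (key c hcd a b m)⟩⟩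
      have hac : a ≠ c := by
        rintro rfl
        rcases m.left_mem with h0 | h0
        · have := mc.mp (Or.inl hcD)
          omega
        · exact h.notMem _ hcD h0
      exact lt_of_le_of_ne m.left_le hac
    · have hw' : c < w ∧ w < d ∧ w ∈ U := by
        rcases hw with hw | hw | hw
        · exact absurd hw.2 hcD
        · exact hw
        · exact absurd hdU (dd hw.2)
      have := md.mp (Or.inr hdU)
      refine ⟨w, by omega, by omega, fun a b m => ⟨Or.inl ?_, Or.inr (key w hw'.2.1 a b m)⟩⟩
      have h1 := m.le_left w hw'.2.2 le_rfl
      have h2 := m.left_le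
      obtain rfl : a = w := by omega
      exact ⟨hw'.1, hw'.2.2⟩
  · by_cases hcD : c ∈ D
    · have hv' : c < v ∧ v < d ∧ v ∈ D := by
        rcases hv with hv | hv | hv
        · exact absurd hv.2 (dc hcD)
        · exact hv
        · exact absurd hv.2 hdU
      have := mc.mp (Or.inl hcD)
      refine ⟨v - 1, by omega, by omega, fun a b m => ?_⟩
      have h1 := m.right_le v hv'.2.2 (by omega)
      have h2 := m.lt_right
      obtain rfl : b = v := by omega
      refine ⟨?_, Or.inr (Or.inr hv'.2)⟩
      rcases lt_trichotomy a c with hac | rfl | hac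
      · exact Or.inr (Or.inl ⟨hac, hv'.1, hcD⟩)
      · rcases m.left_mem with h0 | h0
        · omega
        · exact absurd h0 (dc hcD)
      · exact Or.inl ⟨hac, m.left_mem.resolve_left (by omega)⟩
    · by_cases hum : ∃ u ∈ U, ∃ m ∈ D, c < u ∧ u < m ∧ m < d
      · obtain ⟨u, hu, x, hx, h1, h2, h3⟩ := hum
        refine ⟨x - 1, by omega, by omega, fun a b m => ?_⟩
        have h4 := m.right_le x hx (by omega)
        have h5 := m.lt_right
        obtain rfl : b = x := by omega
        have h6 := m.le_left u hu (by omega)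
        exact ⟨Or.inl ⟨by omega, m.left_mem.resolve_left (by omega)⟩, Or.inr (Or.inr ⟨h3, hx⟩)⟩
      · exfalso
        have hl : c = 0 ∨ c ∈ U := by
          have := mc.mpr
          grind
        have hr : d = n + 2 ∨ d ∈ D := by
          have := md.mpr
          grind
        obtain ⟨x, hmax, hle⟩ : ∃ x, (x = c ∨ x ∈ D ∧ c < x ∧ x < d) ∧
            ∀ y ∈ D, c < y → y < d → y ≤ x := by
          have hs : ∀ x, x ∈ insert c (D.filter (fun x => c < x ∧ x < d)) ↔
              x = c ∨ x ∈ D ∧ c < x ∧ x < d := by simp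
          exact ⟨_, (hs _).mp (Finset.max'_mem _ (Finset.insert_nonempty _ _)), fun y hy h1 h2 =>
            Finset.le_max' _ _ ((hs y).mpr (Or.inr ⟨hy, h1, h2⟩))⟩
        have hcx : c ≤ x ∧ x < d := by
          rcases hmax with rfl | hmax
          · exact ⟨le_rfl, hcd⟩
          · exact ⟨hmax.2.1.le, hmax.2.2⟩
        have hx0 : 1 ≤ x := by
          rcases hl with hl | hl
          · have hv' : c < v ∧ v < d ∧ v ∈ D :=
              (hv.resolve_left fun hv => by omega).resolve_right fun hv => hdU hv.2
            have := hle v hv'.2.2 hv'.1 hv'.2.1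
            omega
          · have := mc.mp (Or.inr hl)
            omega
        have hxn : x ≤ n := by
          by_contra hlt
          have hdD : d ∉ D := fun hdD => by have := md.mp (Or.inl hdD); omega
          have hw' : c < w ∧ w < d ∧ w ∈ U :=
            (hw.resolve_left fun hw => hcD hw.2).resolve_right fun hw => hdD hw.2
          have hwx : w ≠ x := by
            rintro rfl
            rcases hmax with hx | hx
            · omega
            · exact h.notMem _ hx.1 hw'.2.2
          exact hum ⟨w, hw'.2.2, x, (hmax.resolve_left (by omega)).1, by omega, by omega, by omega⟩
        refine hne x hx0 hxn ⟨hl, hcx.1, fun u hu hux => ?_, hr, hcx.2, fun y hy hxy => ?_, hd⟩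
        · by_contra hlt
          have := h.notMem x
          rcases hmax with rfl | hx
          · omega
          · refine hum ⟨u, hu, x, hx.1, by omega, ?_, hx.2.2⟩
            rcases eq_or_lt_of_le hux with rfl | hux
            · exact absurd hu (this hx.1)
            · exact hux
        · by_contra hlt
          have := hle y hy (by omega) (by omega)
          omega

theorem isTriangulation_minDiag (h : IsLabelSplit n D U) :
    IsTriangulation n D U ((Finset.Icc 1 n).image (minDiag n D U)) := by
  refine ⟨fun δ hδ => ?_, fun δ hδ δ' hδ' => ?_, ?_⟩
  · obtain ⟨i, hi, rfl⟩ := Finset.mem_image.mp hδ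
    rw [Finset.mem_Icc] at hi
    exact isInternalDiag_minDiag h hi.1 hi.2
  · obtain ⟨i, hi, rfl⟩ := Finset.mem_image.mp hδ
    obtain ⟨j, hj, rfl⟩ := Finset.mem_image.mp hδ'
    rw [Finset.mem_Icc] at hi hj
    exact (isMinDiag_minDiag h (by omega)).not_cross h (isMinDiag_minDiag h (by omega))
  · rintro ⟨c, d⟩ ⟨⟨hcd, hd⟩, hnb⟩ hmem
    simp only at hcd hd
    by_contra hno
    have hno' : ∀ i, 1 ≤ i → i ≤ n → ∀ x y, (x = c ∧ y = d) ∨ (x = d ∧ y = c) →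
        Under D U (minDiag n D U i).1 (minDiag n D U i).2 x →
        Under U D (minDiag n D U i).1 (minDiag n D U i).2 y → False := by
      intro i h1 h2 x y hxy hx hy
      have m := isMinDiag_minDiag h (show i ≤ n + 1 by omega)
      have hl := m.left_le
      have hr := m.lt_right
      have hlt : (minDiag n D U i).1 < (minDiag n D U i).2 := by omega
      exact hno ⟨_, Finset.mem_image_of_mem _ (Finset.mem_Icc.mpr ⟨h1, h2⟩),
        cross_of_under h hlt m.right_le_last hcd hd hx hy hxy⟩
    clear hno
    have hmem' : ∀ i, 1 ≤ i → i ≤ n → ¬ IsMinDiag n D U i c d := fun i h1 h2 m =>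
      hmem (Finset.mem_image.mpr ⟨i, Finset.mem_Icc.mpr ⟨h1, h2⟩, m.eq h (by omega)⟩)
    rw [isBoundaryEdge_iff h] at hnb
    push Not at hnb
    obtain ⟨⟨v, -, hv⟩, ⟨w, -, hw⟩⟩ := hnb hcd hd
    obtain ⟨i, h1, h2, hi⟩ := exists_isMinDiag_under h hcd hd hv hw hmem'
    obtain ⟨hc, hd'⟩ := hi _ _ (isMinDiag_minDiag h (by omega))
    exact hno' i h1 h2 c d (Or.inl ⟨rfl, rfl⟩) hc hd'

theorem edgeOf_minDiag (h : IsLabelSplit n D U) {i a b : ℕ} (hi : i ≤ n + 1)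
    (m : IsMinDiag n D U i a b) :
    EdgeOf n D U ((Finset.Icc 1 n).image (minDiag n D U)) a b := by
  by_cases hin : 1 ≤ i ∧ i ≤ n
  · exact Or.inl (Finset.mem_image.mpr ⟨i, Finset.mem_Icc.mpr hin, m.eq h hi⟩)
  · refine Or.inr ?_
    obtain ⟨h1, h2, h3, h4, h5, h6, h7⟩ := m
    rw [isBoundaryEdge_iff h]
    refine ⟨by omega, h7, ?_⟩
    have ha := h.mem_or a
    have hb := h.mem_or b
    have hdb := h.notMem b
    have hda := h.notMem a
    rcases Nat.lt_or_ge i 1 with hi0 | hi0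
    · left
      intro v hv hu
      unfold Under at hu
      have h6v := h6 v
      grind
    · right
      intro v hv hu
      unfold Under at hu
      have h3v := h3 v
      have hv := h.mem_or v
      grind

theorem isBoundaryEdge_minDiag_zero (h : IsLabelSplit n D U) :
    IsBoundaryEdge n D U (minDiag n D U 0) := by
  have m := isMinDiag_minDiag h (Nat.zero_le (n + 1))
  generalize minDiag n D U 0 = δ at *
  obtain ⟨a, b⟩ := δ
  obtain ⟨h1, h2, h3, h4, h5, h6, h7⟩ := m
  simp only at *
  refine (isBoundaryEdge_iff h).mpr ⟨by omega, h7, Or.inl fun v hv hu => ?_⟩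
  have hb := h.mem_or b
  have hdb := h.notMem b
  have ha := h.mem_or a
  unfold Under at hu
  have h6v := h6 v
  grind

theorem xcoord_minDiag (h : IsLabelSplit n D U) {j : ℕ} (hj1 : 1 ≤ j) (hj : j ≤ n + 1) :
    xcoord n D U ((Finset.Icc 1 n).image (minDiag n D U)) j = j := by
  have hT := isTriangulation_minDiag h
  have m := isMinDiag_minDiag h (show j - 1 ≤ n + 1 by omega)
  have m' := isMinDiag_minDiag h hj
  have e := edgeOf_minDiag h (by omega) m
  have e' := edgeOf_minDiag h hj m'
  have hb := bel_minDiag h (show j - 1 ≤ n + 1 by omega)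
  have hb' := bel_minDiag h hj
  generalize minDiag n D U (j - 1) = δ at *
  generalize minDiag n D U j = δ' at *
  obtain ⟨a, b⟩ := δ
  obtain ⟨a', b'⟩ := δ'
  obtain ⟨h1, h2, h3, h4, h5, h6, h7⟩ := m
  obtain ⟨h1', h2', h3', h4', h5', h6', h7'⟩ := m'
  simp only at *
  have hbelcard : bel n D U (a, b) = j - 1 := by rw [bel, hb]; simp
  have hbelcard' : bel n D U (a', b') = j := by rw [bel, hb']; simp
  rcases (h.mem_or j).mpr ⟨hj1, hj⟩ with hjD | hjU
  · have hjU := h.notMem j hjD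
    have hbj : b = j := by
      have := h6 j hjD (by omega)
      omega
    have haa : a' = a := by
      have h3a := h3 a'
      have h3a' := h3' a
      have hm := h.mem_or a'
      grind
    subst hbj haa
    have hempty : Bel n D U (b, b') = ∅ := by
      ext v
      rw [mem_bel_iff h h5' h7']
      have := h6' v
      have := h.notMem b'
      have := h.mem_or b'
      simp only [Finset.notMem_empty, iff_false]
      grind
    have hbd : IsBoundaryEdge n D U (b, b') := by
      refine (isBoundaryEdge_iff h).mpr ⟨h5', h7', Or.inl fun v hv hu => ?_⟩
      unfold Under at hu
      have := h6' v
      have := h.notMem b'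
      have := h.mem_or b'
      grind
    rw [xcoord_eq h hT ⟨by omega, h5', h7', e, Or.inr hbd, e'⟩, if_pos hjD, hbelcard, bel, hempty]
    push_cast [hj1]
    simp
  · have hjD : j ∉ D := fun hjD => h.notMem j hjD hjU
    have haj : a' = j := by
      have := h3' j hjU le_rfl
      omega
    have hbb : b' = b := by
      have h6a := h6 b'
      have h6b := h6' b
      have hm := h.mem_or b
      grind
    subst haj hbb
    have haa' : a < a' := by omega
    have hfull : Bel n D U (a, a') = Finset.Icc 1 (n + 1) := by
      ext v
      rw [mem_bel_iff h haa' (by omega), Finset.mem_Icc]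
      have := h3 v
      have := h.mem_or v
      have := h.notMem v
      grind
    have hbd : IsBoundaryEdge n D U (a, a') := by
      refine (isBoundaryEdge_iff h).mpr ⟨haa', by omega, Or.inr fun v hv hu => ?_⟩
      unfold Under at hu
      have := h3 v
      have := h.notMem a
      have := h.mem_or a
      grind
    rw [xcoord_eq h hT ⟨haa', h5', h7', Or.inr hbd, e', e⟩, if_neg hjD, hbelcard', bel, hfull]
    simp
    ring

end MinDiag

section Coordinates

variable {n : ℕ} {D U : Finset ℕ} {T : Finset (ℕ × ℕ)}

theorem exists_edgeOf_bel_swap_eq_empty (h : IsLabelSplit n D U) (T : Finset (ℕ × ℕ)) :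
    ∃ a b, EdgeOf n D U T a b ∧ Bel n U D (a, b) = ∅ := by
  refine ⟨(minDiag n U D 0).1, (minDiag n U D 0).2, Or.inr ?_, ?_⟩
  · exact (isBoundaryEdge_swap h _).mp (isBoundaryEdge_minDiag_zero h.symm)
  · exact bel_minDiag h.symm (Nat.zero_le _)

theorem exists_isTriangleOf (h : IsLabelSplit n D U) (hT : IsTriangulation n D U T) {j : ℕ}
    (hj1 : 1 ≤ j) (hj : j ≤ n + 1) : ∃ i k, IsTriangleOf n D U T i j k := by
  by_contra! hno
  obtain ⟨a, b, e, he⟩ := exists_edgeOf_bel_swap_eq_empty h T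
  have hne : ∀ i v k, IsTriangleOf n D U T i v k → v ≠ j := by
    rintro i v k t rfl
    exact hno i k t
  have key := potential_le_sum h hT (g := fun _ _ => 0) (G := 0)
    (y := fun v => if v = j then (-1 : ℝ) else 0) (fun _ _ _ _ => le_rfl) (fun _ _ _ _ => le_rfl)
    (fun i v k t _ => by simp [hne i v k t]) (fun i v k t _ => by simp [hne i v k t]) e he
  rw [Finset.sum_ite_eq', if_pos (Finset.mem_Icc.mpr ⟨hj1, hj⟩)] at key
  norm_num at key

theorem bel_swap_card (h : IsLabelSplit n D U) {a b : ℕ} (hab : a < b) (hb : b ≤ n + 2) :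
    (bel n U D (a, b) : ℝ) = n + 1 - bel n D U (a, b) := by
  have hle := Finset.card_le_card (bel_subset (n := n) (D := D) (U := U) (a, b))
  rw [bel, bel_swap h hab hb, Finset.card_sdiff_of_subset (bel_subset _), Nat.cast_sub hle, bel]
  simp

theorem xcoord_swap (h : IsLabelSplit n D U) (hT : IsTriangulation n D U T) {j : ℕ}
    (hj1 : 1 ≤ j) (hj : j ≤ n + 1) : xcoord n U D T j = n + 2 - xcoord n D U T j := by
  obtain ⟨i, k, t⟩ := exists_isTriangleOf h hT hj1 hj
  have hij := t.1
  have hjk := t.2.1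
  have hk := t.2.2.1
  rw [xcoord_eq h hT t, xcoord_eq h.symm (hT.swap h) ((isTriangleOf_swap h T i j k).mpr t),
    bel_swap_card h hij (by omega), bel_swap_card h hjk hk]
  have hdj := h.notMem j
  have hmj := (h.mem_or j).mpr ⟨hj1, hj⟩
  by_cases hD : j ∈ D
  · rw [if_neg (hdj hD), if_pos hD]
    ring
  · rw [if_pos (hmj.resolve_left hD), if_neg hD]
    ring

end Coordinates

section PrefixSums

variable {n : ℕ} {D U : Finset ℕ} {T : Finset (ℕ × ℕ)}

theorem bel_sub_sum_eq (p : ℕ) (δ : ℕ × ℕ) :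
    (bel n D U δ : ℝ) - ∑ w ∈ Bel n D U δ, (if w ≤ p then (1 : ℝ) else 0) =
      ∑ w ∈ Bel n D U δ, (if p < w then (1 : ℝ) else 0) := by
  rw [bel, Finset.card_eq_sum_ones, Nat.cast_sum, ← Finset.sum_sub_distrib]
  refine Finset.sum_congr rfl fun w _ => ?_
  by_cases hw : w ≤ p
  · simp [hw]
  · simp [hw, not_le.mp hw]

theorem sum_Icc_ite_le {p m : ℕ} (hp : p ≤ m) (f : ℕ → ℝ) :
    ∑ j ∈ Finset.Icc 1 m, (if j ≤ p then f j else 0) = ∑ j ∈ Finset.Icc 1 p, f j := by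
  rw [← Finset.sum_filter]
  refine Finset.sum_congr ?_ fun _ _ => rfl
  ext j
  simp only [Finset.mem_filter, Finset.mem_Icc]
  omega

theorem triangular_le_sum_xcoord (h : IsLabelSplit n D U) (hT : IsTriangulation n D U T) {p : ℕ}
    (hp1 : 1 ≤ p) (hp : p ≤ n + 1) :
    triangular p ≤ ∑ j ∈ Finset.Icc 1 p, xcoord n D U T j := by
  obtain ⟨a, b, e, he⟩ := exists_edgeOf_bel_swap_eq_empty h T
  have key := triangular_add_le_sum_ite_xcoord h hT hp le_rfl hp1 (le_refl (0 : ℝ))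
      (fun a b _ _ _ => by
    rw [bel_sub_sum_eq]
    exact (Finset.sum_eq_zero fun w _ => by simp).le.trans
      (Finset.sum_nonneg fun w _ => by split_ifs <;> norm_num)) e he
  rwa [add_zero, sum_Icc_ite_le hp] at key

theorem sum_Icc_cast_eq (p : ℕ) : ∑ k ∈ Finset.Icc 1 p, (k : ℝ) = triangular p := by
  induction p with
  | zero => simp [triangular]
  | succ p ih =>
    rw [Finset.sum_Icc_succ_top (by omega), ih, triangular, triangular]
    push_cast
    ring

theorem sum_xcoord (h : IsLabelSplit n D U) (hT : IsTriangulation n D U T) :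
    ∑ j ∈ Finset.Icc 1 (n + 1), xcoord n D U T j = triangular (n + 1 : ℕ) := by
  apply le_antisymm
  · have h1 := triangular_le_sum_xcoord h.symm (hT.swap h) (show 1 ≤ n + 1 by omega) le_rfl
    have h2 : ∑ j ∈ Finset.Icc 1 (n + 1), xcoord n U D T j =
        ∑ j ∈ Finset.Icc 1 (n + 1), ((n : ℝ) + 2 - xcoord n D U T j) :=
      Finset.sum_congr rfl fun j hj => by
        rw [Finset.mem_Icc] at hj
        exact xcoord_swap h hT hj.1 hj.2
    rw [h2, Finset.sum_sub_distrib] at h1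
    simp only [Finset.sum_const, Nat.card_Icc, nsmul_eq_mul, triangular] at h1 ⊢
    push_cast at h1 ⊢
    linarith
  · exact triangular_le_sum_xcoord h hT (by omega) le_rfl

/-- Among the edges of a triangulation that straddle a common vertical line, the sets `Bel` form a
chain. -/
theorem EdgeOf.mem_bel_of_straddle (h : IsLabelSplit n D U) (hT : IsTriangulation n D U T)
    {a b c d p u v : ℕ} (e : EdgeOf n D U T a b) (e' : EdgeOf n D U T c d)
    (ha : a ≤ p) (hb : p < b) (hc : c ≤ p) (hd : p < d)
    (hu : u ∈ Bel n D U (a, b)) (hu' : u ∉ Bel n D U (c, d)) (hv : v ∈ Bel n D U (c, d)) :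
    v ∈ Bel n D U (a, b) := by
  by_contra hv'
  obtain ⟨hab, hbn⟩ := e.bounds hT
  obtain ⟨hcd, hdn⟩ := e'.bounds hT
  have k1 : ¬ (Under D U a b c ∧ Under U D a b d) := fun k =>
    e.not_under h hT e' k.1 k.2 (Or.inl ⟨rfl, rfl⟩)
  have k2 : ¬ (Under D U a b d ∧ Under U D a b c) := fun k =>
    e.not_under h hT e' k.1 k.2 (Or.inr ⟨rfl, rfl⟩)
  rw [mem_bel_iff h hab hbn] at hu hv'
  rw [mem_bel_iff h hcd hdn] at hu' hv
  unfold Under at k1 k2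
  have ma := h.mem_or a
  have mb := h.mem_or b
  have mc := h.mem_or c
  have md := h.mem_or d
  have da := h.notMem a
  have db := h.notMem b
  have dc := h.notMem c
  have dd := h.notMem d
  have du := h.notMem u
  have dv := h.notMem v
  have mu := h.mem_or u
  have mv := h.mem_or v
  rcases hu with ⟨mu1, hu | hu | hu⟩ <;> rcases hv with ⟨mv1, hv | hv | hv⟩ <;>
    grind

theorem triangular_add_one_le_sum_xcoord (h : IsLabelSplit n D U) (hT : IsTriangulation n D U T)
    {p : ℕ} (hp1 : 1 ≤ p) (hp : p ≤ n) (hmem : minDiag n D U p ∉ T) :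
    triangular p + 1 ≤ ∑ j ∈ Finset.Icc 1 p, xcoord n D U T j := by
  obtain ⟨δ, hδ, hcross⟩ := hT.2.2 _ (isInternalDiag_minDiag h hp1 hp) hmem
  have m := isMinDiag_minDiag h (show p ≤ n + 1 by omega)
  generalize minDiag n D U p = δ' at *
  obtain ⟨a, b⟩ := δ'
  obtain ⟨c, d⟩ := δ
  have e' : EdgeOf n D U T c d := Or.inl hδ
  obtain ⟨hcd, hd⟩ := e'.bounds hT
  obtain ⟨h1, h2, h3, h4, h5, h6, h7⟩ := m
  obtain ⟨-, -, hac, had, hbc, hbd, hc⟩ := hcross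
  simp only at *
  rw [strictBetween_iff_under h (by omega) h7 (by omega),
    strictBetween_iff_under h (by omega) h7 (by omega),
    strictBetween_rev_iff_under h (by omega) h7 (by omega),
    strictBetween_rev_iff_under h (by omega) h7 (by omega)] at hc
  have ma := h.mem_or a
  have mb := h.mem_or b
  have mc := h.mem_or c
  have md := h.mem_or d
  have da := h.notMem a
  have db := h.notMem b
  have dc := h.notMem c
  have dd := h.notMem d
  unfold Under at hc
  have hbU : b ∉ U := fun hbU => by
    rcases h4 with h4 | h4
    · have := mb.mp (Or.inr hbU)
      omega
    · exact db h4 hbU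
  have haD : a ∉ D := fun haD => by
    rcases h1 with h1 | h1
    · have := ma.mp (Or.inl haD)
      omega
    · exact da haD h1
  have hpc : c ∈ D → c < b → c ≤ p := fun hcD hcb => by
    by_contra hlt
    have := h6 c hcD (by omega)
    omega
  have hpd : d ∈ D → d < b → d ≤ p := fun hdD hdb => by
    by_contra hlt
    have := h6 d hdD (by omega)
    omega
  have hpc' : c ∈ U → a < c → p < c := fun hcU hac => by
    by_contra hlt
    have := h3 c hcU (by omega)
    omega
  have hpd' : d ∈ U → a < d → p < d := fun hdU had => by
    by_contra hlt
    have := h3 d hdU (by omega)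
    omega
  have hcpd : c ≤ p ∧ p < d := by grind
  obtain ⟨hcp, hdp⟩ := hcpd
  obtain ⟨u, hu1, hup, hu⟩ : ∃ u, 1 ≤ u ∧ u ≤ p ∧ u ∉ Bel n D U (c, d) := by
    by_cases hcD : c ∈ D
    · refine ⟨c, (mc.mp (Or.inl hcD)).1, hcp, fun hu => ?_⟩
      rw [mem_bel_iff h hcd hd] at hu
      grind
    · refine ⟨a, ?_, h2, fun hu => ?_⟩
      · grind
      · rw [mem_bel_iff h hcd hd] at hu
        grind
  obtain ⟨v, hpv, hv⟩ : ∃ v, p < v ∧ v ∈ Bel n D U (c, d) := by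
    by_cases hdU : d ∈ U
    · refine ⟨d, hdp, ?_⟩
      rw [mem_bel_iff h hcd hd]
      grind
    · refine ⟨b, h5, ?_⟩
      rw [mem_bel_iff h hcd hd]
      grind
  obtain ⟨x, y, e, he⟩ := exists_edgeOf_bel_swap_eq_empty h T
  have key := triangular_add_le_sum_ite_xcoord h hT (by omega) hu1 hup zero_le_one
      (fun x y e hx hy => by
    rw [bel_sub_sum_eq, Finset.sum_ite_eq']
    have hnonneg : ∀ w ∈ Bel n D U (x, y), (0 : ℝ) ≤ if p < w then (1 : ℝ) else 0 :=
      fun w _ => by split_ifs <;> norm_num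
    split_ifs with hux
    · have hvx := e.mem_bel_of_straddle h hT e' hx hy hcp hdp hux hu hv
      simpa [hpv] using Finset.single_le_sum hnonneg hvx
    · exact Finset.sum_nonneg hnonneg) e he
  rwa [sum_Icc_ite_le (by omega)] at key

theorem exists_minDiag_notMem (h : IsLabelSplit n D U) (hT : IsTriangulation n D U T)
    (hne : T ≠ (Finset.Icc 1 n).image (minDiag n D U)) :
    ∃ p, 1 ≤ p ∧ p ≤ n ∧ minDiag n D U p ∉ T := by
  by_contra! hall
  refine hne (Finset.Subset.antisymm (fun δ hδ => ?_) fun δ hδ => ?_)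
  · by_contra hmem
    obtain ⟨δ', hδ', hc⟩ := (isTriangulation_minDiag h).2.2 δ (hT.1 δ hδ) hmem
    obtain ⟨i, hi, rfl⟩ := Finset.mem_image.mp hδ'
    rw [Finset.mem_Icc] at hi
    exact hT.2.1 δ hδ _ (hall i hi.1 hi.2) hc
  · obtain ⟨i, hi, rfl⟩ := Finset.mem_image.mp hδ
    rw [Finset.mem_Icc] at hi
    exact hall i hi.1 hi.2

theorem sum_sub_two_mul_mul (c : ℝ) (z : ℕ → ℝ) (m : ℕ) :
    ∑ k ∈ Finset.Icc 1 m, (c - 2 * (k : ℝ)) * z k =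
      (c - 2 * m - 2) * ∑ k ∈ Finset.Icc 1 m, z k +
        2 * ∑ p ∈ Finset.Icc 1 m, ∑ k ∈ Finset.Icc 1 p, z k := by
  induction m with
  | zero => simp
  | succ m ih =>
    simp only [Finset.sum_Icc_succ_top (show 1 ≤ m + 1 by omega), ih]
    push_cast
    ring

theorem sum_mul_self_lt_sum_mul_xcoord (h : IsLabelSplit n D U) (hT : IsTriangulation n D U T)
    (hne : T ≠ (Finset.Icc 1 n).image (minDiag n D U)) :
    ∑ k ∈ Finset.Icc 1 (n + 1), (((n : ℝ) + 2) - 2 * (k : ℝ)) * (k : ℝ) <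
      ∑ k ∈ Finset.Icc 1 (n + 1), (((n : ℝ) + 2) - 2 * (k : ℝ)) * xcoord n D U T k := by
  have hz : ∀ p, ∑ k ∈ Finset.Icc 1 p, (xcoord n D U T k - (k : ℝ)) =
      ∑ k ∈ Finset.Icc 1 p, xcoord n D U T k - triangular p := fun p => by
    rw [Finset.sum_sub_distrib, sum_Icc_cast_eq]
  have key := sum_sub_two_mul_mul ((n : ℝ) + 2) (fun k => xcoord n D U T k - (k : ℝ)) (n + 1)
  simp only [hz, sum_xcoord h hT, sub_self, mul_zero, zero_add, mul_sub,
    Finset.sum_sub_distrib (fun k : ℕ => (((n : ℝ) + 2) - 2 * (k : ℝ)) * xcoord n D U T k)] at key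
  obtain ⟨p, hp1, hp, hmem⟩ := exists_minDiag_notMem h hT hne
  have hpos : 0 < ∑ p ∈ Finset.Icc 1 (n + 1),
      (∑ k ∈ Finset.Icc 1 p, xcoord n D U T k - triangular p) := by
    refine Finset.sum_pos' (fun q hq => ?_) ⟨p, Finset.mem_Icc.mpr ⟨hp1, by omega⟩, ?_⟩
    · rw [Finset.mem_Icc] at hq
      exact sub_nonneg.mpr (triangular_le_sum_xcoord h hT hq.1 hq.2)
    · have := triangular_add_one_le_sum_xcoord h hT hp1 hp hmem
      linarith
  linarith

theorem sum_mul_xcoord_swap (h : IsLabelSplit n D U) (hT : IsTriangulation n D U T) :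
    ∑ k ∈ Finset.Icc 1 (n + 1), (((n : ℝ) + 2) - 2 * (k : ℝ)) * xcoord n U D T k =
      -∑ k ∈ Finset.Icc 1 (n + 1), (((n : ℝ) + 2) - 2 * (k : ℝ)) * xcoord n D U T k := by
  have h0 : ∑ k ∈ Finset.Icc 1 (n + 1), (((n : ℝ) + 2) - 2 * (k : ℝ)) = 0 := by
    rw [Finset.sum_sub_distrib, ← Finset.mul_sum, sum_Icc_cast_eq, triangular]
    simp
    ring
  rw [eq_neg_iff_add_eq_zero, ← Finset.sum_add_distrib, ← mul_zero ((n : ℝ) + 2), ← h0,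
    Finset.mul_sum]
  refine Finset.sum_congr rfl fun k hk => ?_
  rw [Finset.mem_Icc] at hk
  rw [xcoord_swap h hT hk.1 hk.2]
  ring

end PrefixSums

section MaxDiag

variable {n : ℕ} {D U : Finset ℕ}

theorem maxDiag_eq (i : ℕ) : maxDiag n D U i = minDiag n U D (n + 1 - i) := rfl

theorem image_maxDiag :
    (Finset.Icc 1 n).image (maxDiag n D U) = (Finset.Icc 1 n).image (minDiag n U D) := by
  ext δ
  simp only [Finset.mem_image, Finset.mem_Icc, maxDiag_eq]
  constructor
  · rintro ⟨i, hi, rfl⟩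
    exact ⟨n + 1 - i, by omega, rfl⟩
  · rintro ⟨i, hi, rfl⟩
    exact ⟨n + 1 - i, by omega, by rw [show n + 1 - (n + 1 - i) = i by omega]⟩

theorem bel_maxDiag (h : IsLabelSplit n D U) {i : ℕ} (hi : i ≤ n + 1) :
    Bel n D U (maxDiag n D U i) = Finset.Icc (n + 2 - i) (n + 1) := by
  have m := isMinDiag_minDiag h.symm (show n + 1 - i ≤ n + 1 by omega)
  have hl := m.left_le
  have hr := m.lt_right
  have hlt : (minDiag n U D (n + 1 - i)).1 < (minDiag n U D (n + 1 - i)).2 := by omega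
  have key := bel_swap h.symm hlt m.right_le_last
  rw [Prod.mk.eta, bel_minDiag h.symm (by omega)] at key
  rw [maxDiag_eq, key]
  ext j
  simp only [Finset.mem_sdiff, Finset.mem_Icc]
  omega

end MaxDiag

/-- `T_min = {δ_1,…,δ_n}` and `T_max = {δ'_1,…,δ'_n}` are
triangulations with `Bel(δ_i) = [i]` and `Bel(δ'_i) = {n+2−i,…,n+1}`; moreover
`x(T_min) = (1,…,n+1)`, `x(T_max) = (n+1,…,1)`, `T_min` is the unique minimizer and
`T_max` the unique maximizer of `⟨u⋆, x(·)⟩` where `u⋆ = (n, n−2, …, −n)`. -/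
theorem minimal_and_maximal_triangulations (n : ℕ) (hn : 1 ≤ n) (D U : Finset ℕ)
    (hUD : D ∪ U = Finset.Icc 1 (n + 1)) (hdisj : Disjoint D U) :
    IsTriangulation n D U ((Finset.Icc 1 n).image (minDiag n D U)) ∧
    IsTriangulation n D U ((Finset.Icc 1 n).image (maxDiag n D U)) ∧
    (∀ i ∈ Finset.Icc 1 n,
      Bel n D U (minDiag n D U i) = Finset.Icc 1 i ∧
      Bel n D U (maxDiag n D U i) = Finset.Icc (n + 2 - i) (n + 1)) ∧
    (∀ j ∈ Finset.Icc 1 (n + 1),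
      xcoord n D U ((Finset.Icc 1 n).image (minDiag n D U)) j = (j : ℝ) ∧
      xcoord n D U ((Finset.Icc 1 n).image (maxDiag n D U)) j = ((n : ℝ) + 2) - (j : ℝ)) ∧
    (∀ T : Finset (ℕ × ℕ), IsTriangulation n D U T →
      T ≠ (Finset.Icc 1 n).image (minDiag n D U) →
      (∑ k ∈ Finset.Icc 1 (n + 1), (((n : ℝ) + 2) - 2 * (k : ℝ)) *
          xcoord n D U ((Finset.Icc 1 n).image (minDiag n D U)) k)
        < ∑ k ∈ Finset.Icc 1 (n + 1), (((n : ℝ) + 2) - 2 * (k : ℝ)) * xcoord n D U T k) ∧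
    (∀ T : Finset (ℕ × ℕ), IsTriangulation n D U T →
      T ≠ (Finset.Icc 1 n).image (maxDiag n D U) →
      (∑ k ∈ Finset.Icc 1 (n + 1), (((n : ℝ) + 2) - 2 * (k : ℝ)) * xcoord n D U T k)
        < ∑ k ∈ Finset.Icc 1 (n + 1), (((n : ℝ) + 2) - 2 * (k : ℝ)) *
            xcoord n D U ((Finset.Icc 1 n).image (maxDiag n D U)) k) := by
  have h := IsLabelSplit.of_union_eq hUD hdisj
  have hmin := isTriangulation_minDiag h
  have hmax : IsTriangulation n D U ((Finset.Icc 1 n).image (maxDiag n D U)) := by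
    rw [image_maxDiag]
    exact (isTriangulation_minDiag h.symm).swap h.symm
  have hxmin : ∀ j ∈ Finset.Icc 1 (n + 1),
      xcoord n D U ((Finset.Icc 1 n).image (minDiag n D U)) j = (j : ℝ) := fun j hj => by
    rw [Finset.mem_Icc] at hj
    exact xcoord_minDiag h hj.1 hj.2
  have hxmax : ∀ j ∈ Finset.Icc 1 (n + 1),
      xcoord n U D ((Finset.Icc 1 n).image (maxDiag n D U)) j = (j : ℝ) := fun j hj => by
    rw [Finset.mem_Icc] at hj
    rw [image_maxDiag]
    exact xcoord_minDiag h.symm hj.1 hj.2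
  refine ⟨hmin, hmax, fun i hi => ?_, fun j hj => ⟨hxmin j hj, ?_⟩, fun T hT hne => ?_,
    fun T hT hne => ?_⟩
  · rw [Finset.mem_Icc] at hi
    exact ⟨bel_minDiag h (by omega), bel_maxDiag h (by omega)⟩
  · have hx := hxmax j hj
    rw [Finset.mem_Icc] at hj
    rw [xcoord_swap h.symm (hmax.swap h) hj.1 hj.2, hx]
  · rw [Finset.sum_congr rfl fun k hk => by rw [hxmin k hk]]
    exact sum_mul_self_lt_sum_mul_xcoord h hT hne
  · rw [image_maxDiag] at hne
    have key := sum_mul_self_lt_sum_mul_xcoord h.symm (hT.swap h) hne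
    rw [sum_mul_xcoord_swap h.symm (hT.swap h), sum_mul_xcoord_swap h.symm (hmax.swap h),
      neg_lt_neg_iff]
    rwa [Finset.sum_congr rfl fun k hk => by rw [hxmax k hk]]

end Spines
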